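/- There exists a universal constant C ≥ 0 such that for every n ∈ ℕ, every H_n-invariant, isotropic, log-concave probability measure η on ℝ^n, and every degree-3 homogeneous polynomial f : ℝ^n → ℝ with coeff_3(f) = 1: ∫ f² dη ≥ 108/175 − C/n. -/

import Mathlib

open MeasureTheory

noncomputable section

/-- Variance of a real function with respect to a measure. -/
def mVar {α : Type*} [MeasurableSpace α] (μ : Measure α) (f : α → ℝ) : ℝ :=
  (∫ x, f x ^ 2 ∂μ) - (∫ x, f x ∂μ) ^ 2

/-- `coeffNorm d f` is `coeff_d(f)`, the ℓ² norm of the coefficients of the degree-`d`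
homogeneous part of `f`. -/
def coeffNorm {n : ℕ} (d : ℕ) (f : MvPolynomial (Fin n) ℝ) : ℝ :=
  Real.sqrt (∑ I ∈ f.support.filter (fun I => (I.sum fun _ e => e) = d),
    (MvPolynomial.coeff I f) ^ 2)

/-- A measure on ℝ^n is log-concave if it has a log-concave density w.r.t. Lebesgue measure. -/
def IsLogConcave {n : ℕ} (μ : Measure (Fin n → ℝ)) : Prop :=
  ∃ ρ : (Fin n → ℝ) → ℝ, (∀ x, 0 ≤ ρ x) ∧
    μ = volume.withDensity (fun x => ENNReal.ofReal (ρ x)) ∧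
    ∀ x y : Fin n → ℝ, ∀ l : ℝ, 0 ≤ l → l ≤ 1 →
      ρ x ^ l * ρ y ^ (1 - l) ≤ ρ (l • x + (1 - l) • y)

/-- A measure on ℝ^n is `H_n`-invariant if it is invariant under all coordinate permutations
and all sign changes of the coordinates. -/
def IsHnInvariant {n : ℕ} (μ : Measure (Fin n → ℝ)) : Prop :=
  (∀ σ : Equiv.Perm (Fin n), Measure.map (fun x => x ∘ σ) μ = μ) ∧
  (∀ ε : Fin n → ℝ, (∀ i, ε i = 1 ∨ ε i = -1) →
    Measure.map (fun x i => ε i * x i) μ = μ)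

/-- A measure on ℝ^n is isotropic if it is centered with identity covariance. -/
def IsIsotropic {n : ℕ} (μ : Measure (Fin n → ℝ)) : Prop :=
  (∀ i, ∫ x, x i ∂μ = 0) ∧
  (∀ i j, ∫ x, x i * x j ∂μ = if i = j then (1 : ℝ) else 0)

/-- The one-dimensional Brunn-Minkowski inequality. -/
lemma volume_add_le_of_add_mem {A B S : Set ℝ} (hA : MeasurableSet A) (hB : MeasurableSet B)
    (hA' : A.Nonempty) (hB' : B.Nonempty) (h : ∀ x ∈ A, ∀ y ∈ B, x + y ∈ S) :
    volume A + volume B ≤ volume S := by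
  have key : ∀ K L : Set ℝ, IsCompact K → IsCompact L → K ⊆ A → L ⊆ B → K.Nonempty →
      L.Nonempty → volume K + volume L ≤ volume S := by
    intro K L hK hL hKA hLB hK' hL'
    obtain ⟨a, ha, ha'⟩ := hK.exists_isGreatest hK'
    obtain ⟨b, hb, hb'⟩ := hL.exists_isLeast hL'
    have h1 : volume ((fun x => x + b) '' K) = volume K := by
      simp [Set.image_add_right]
    have h2 : volume ((fun y => a + y) '' L) = volume L := by
      simp [Set.image_add_left]
    rw [← h1, ← h2]
    have hm2 : MeasurableSet ((fun y => a + y) '' L) :=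
      (hL.image (by fun_prop)).measurableSet
    have hdisj : AEDisjoint volume ((fun x => x + b) '' K) ((fun y => a + y) '' L) := by
      refine measure_mono_null (t := {a + b}) ?_ (by simp)
      rintro _ ⟨⟨x, hx, rfl⟩, ⟨y, hy, hxy⟩⟩
      have h3 := ha' hx
      have h4 := hb' hy
      simp only [Set.mem_singleton_iff]
      simp only at hxy
      linarith
    rw [← measure_union₀ hm2.nullMeasurableSet hdisj]
    refine measure_mono ?_
    rintro _ (⟨x, hx, rfl⟩ | ⟨y, hy, rfl⟩)
    · exact h _ (hKA hx) _ (hLB hb)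
    · exact h _ (hKA ha) _ (hLB hy)
  obtain ⟨a, ha⟩ := hA'
  obtain ⟨b, hb⟩ := hB'
  rw [hA.measure_eq_iSup_isCompact, hB.measure_eq_iSup_isCompact]
  simp only [iSup_and']
  refine ENNReal.biSup_add_biSup_le' ⟨∅, by simp⟩ ⟨∅, by simp⟩ ?_
  rintro K ⟨hKA, hK⟩ L ⟨hLB, hL⟩
  refine le_trans (add_le_add (measure_mono (Set.subset_insert a K))
    (measure_mono (Set.subset_insert b L))) ?_
  exact key _ _ (hK.insert a) (hL.insert b) (Set.insert_subset ha hKA)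
    (Set.insert_subset hb hLB) (Set.insert_nonempty _ _) (Set.insert_nonempty _ _)

lemma lintegral_eq_lintegral_meas_lt_of_le_one {f : ℝ → ENNReal} (hf : Measurable f)
    (hf1 : ∀ x, f x ≤ 1) :
    ∫⁻ x, f x = ∫⁻ t in Set.Ioo (0 : ℝ) 1, volume {x | ENNReal.ofReal t < f x} := by
  have hne : ∀ x, f x ≠ ⊤ := fun x => ne_top_of_le_ne_top ENNReal.one_ne_top (hf1 x)
  have h1 : ∫⁻ x, f x = ∫⁻ x, ENNReal.ofReal (f x).toReal := by
    simp only [ENNReal.ofReal_toReal (hne _)]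
  rw [h1, lintegral_eq_lintegral_meas_lt _ (Filter.Eventually.of_forall fun x => by positivity)
    hf.ennreal_toReal.aemeasurable]
  have h2 : ∀ t ∈ Set.Ioi (0 : ℝ), volume {x | t < (f x).toReal} =
      (Set.Ioo (0 : ℝ) 1).indicator
        (fun t => volume {x | ENNReal.ofReal t < f x}) t := by
    intro t ht
    by_cases h : t < 1
    · rw [Set.indicator_of_mem (show t ∈ Set.Ioo (0 : ℝ) 1 from ⟨ht, h⟩)]
      congr 1; ext x
      exact (ENNReal.ofReal_lt_iff_lt_toReal (le_of_lt ht) (hne x)).symm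
    · rw [Set.indicator_of_notMem (fun h' => h h'.2)]
      convert measure_empty (μ := (volume : Measure ℝ))
      ext x
      have : (f x).toReal ≤ 1 := ENNReal.toReal_le_of_le_ofReal zero_le_one (by simpa using hf1 x)
      simp only [Set.mem_ofPred_eq, Set.mem_empty_iff_false, iff_false, not_lt]
      linarith
  rw [setLIntegral_congr_fun measurableSet_Ioi h2, lintegral_indicator measurableSet_Ioo,
    Measure.restrict_restrict measurableSet_Ioo,
    Set.inter_eq_left.2 (fun x hx => hx.1)]

lemma lintegral_add_le_of_min_le {f g h : ℝ → ENNReal} (hf : Measurable f) (hg : Measurable g)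
    (hh : Measurable h) (hf1 : ⨆ x, f x = 1) (hg1 : ⨆ x, g x = 1)
    (H : ∀ x y, min (f x) (g y) ≤ h (x + y)) :
    (∫⁻ x, f x) + ∫⁻ x, g x ≤ ∫⁻ x, h x := by
  have hh' : ∫⁻ x, min (h x) 1 ≤ ∫⁻ x, h x := lintegral_mono fun x => min_le_left _ _
  refine le_trans ?_ hh'
  rw [lintegral_eq_lintegral_meas_lt_of_le_one hf (fun x => hf1 ▸ le_iSup f x),
    lintegral_eq_lintegral_meas_lt_of_le_one hg (fun x => hg1 ▸ le_iSup g x),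
    lintegral_eq_lintegral_meas_lt_of_le_one (hh.min measurable_const) (fun x => min_le_right _ _),
    ← lintegral_add_left']
  · refine setLIntegral_mono' measurableSet_Ioo fun t ht => ?_
    have ht1 : ENNReal.ofReal t < 1 := by
      rw [← ENNReal.ofReal_one]; exact (ENNReal.ofReal_lt_ofReal_iff one_pos).2 ht.2
    obtain ⟨a, ha⟩ := lt_iSup_iff.1 (hf1 ▸ ht1)
    obtain ⟨b, hb⟩ := lt_iSup_iff.1 (hg1 ▸ ht1)
    refine volume_add_le_of_add_mem (measurableSet_lt measurable_const hf)
      (measurableSet_lt measurable_const hg) ⟨a, ha⟩ ⟨b, hb⟩ fun x hx y hy => ?_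
    exact lt_min (lt_of_lt_of_le (lt_min hx hy) (H x y)) ht1
  · refine Measurable.aemeasurable (Antitone.measurable fun s t hst => measure_mono fun x hx => ?_)
    exact lt_of_le_of_lt (ENNReal.ofReal_le_ofReal hst) hx

lemma lintegral_mul_le_sq_of_bounded {f g h : ℝ → ENNReal} (hf : Measurable f) (hg : Measurable g)
    (hh : Measurable h) (hf1 : ⨆ x, f x ≠ ⊤) (hg1 : ⨆ x, g x ≠ ⊤)
    (H : ∀ x y, f x * g y ≤ h (x + y) ^ 2) :
    4 * ((∫⁻ x, f x) * ∫⁻ x, g x) ≤ (∫⁻ x, h x) ^ 2 := by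
  set M := ⨆ x, f x with hM
  set N := ⨆ x, g x with hN
  by_cases hM0 : M = 0
  · have : ∀ x, f x = 0 := fun x => le_antisymm (hM0 ▸ le_iSup f x) zero_le
    simp [this]
  by_cases hN0 : N = 0
  · have : ∀ x, g x = 0 := fun x => le_antisymm (hN0 ▸ le_iSup g x) zero_le
    simp [this]
  set R : ENNReal := (M * N) ^ (1 / 2 : ℝ) with hR
  have hR2 : R ^ 2 = M * N := by
    rw [hR, ← ENNReal.rpow_natCast, ← ENNReal.rpow_mul]; norm_num
  have hMN0 : M * N ≠ 0 := mul_ne_zero hM0 hN0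
  have hMN : M * N ≠ ⊤ := ENNReal.mul_ne_top hf1 hg1
  have hR0 : R ≠ 0 := by rintro h; simp [h] at hR2; tauto
  have hRt : R ≠ ⊤ := by rintro h; simp [h] at hR2; exact hMN hR2.symm
  have key := lintegral_add_le_of_min_le (f := fun x => M⁻¹ * f x) (g := fun x => N⁻¹ * g x)
    (h := fun x => R⁻¹ * h x) (hf.const_mul _) (hg.const_mul _) (hh.const_mul _)
    (by rw [← ENNReal.mul_iSup, ENNReal.inv_mul_cancel hM0 hf1])
    (by rw [← ENNReal.mul_iSup, ENNReal.inv_mul_cancel hN0 hg1])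
    (by
      intro x y
      rw [← ENNReal.pow_le_pow_left_iff (n := 2) (by norm_num), mul_pow, ← ENNReal.inv_pow, hR2,
        ENNReal.mul_inv (Or.inl hM0) (Or.inl hf1)]
      calc _ ≤ (M⁻¹ * f x) * (N⁻¹ * g y) := by
            rw [sq]; exact mul_le_mul' (min_le_left _ _) (min_le_right _ _)
        _ = M⁻¹ * N⁻¹ * (f x * g y) := by ring
        _ ≤ _ := by gcongr; exact H x y)
  rw [lintegral_const_mul _ hf, lintegral_const_mul _ hg, lintegral_const_mul _ hh] at key
  have amgm : ∀ a b : ENNReal, 4 * (a * b) ≤ (a + b) ^ 2 := by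
    intro a b
    by_cases ha : a = ⊤
    · simp [ha]
    by_cases hb : b = ⊤
    · simp [hb]
    lift a to NNReal using ha
    lift b to NNReal using hb
    norm_cast
    rw [← NNReal.coe_le_coe]; push_cast
    nlinarith [sq_nonneg ((a : ℝ) - b)]
  have h3 := (amgm _ _).trans (pow_le_pow_left' key 2)
  rw [mul_pow, ← ENNReal.inv_pow, hR2] at h3
  calc 4 * ((∫⁻ x, f x) * ∫⁻ x, g x)
      = (M * M⁻¹) * (N * N⁻¹) * (4 * ((∫⁻ x, f x) * ∫⁻ x, g x)) := by
        rw [ENNReal.mul_inv_cancel hM0 hf1, ENNReal.mul_inv_cancel hN0 hg1]; ring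
    _ = M * N * (4 * (M⁻¹ * (∫⁻ x, f x) * (N⁻¹ * ∫⁻ x, g x))) := by ring
    _ ≤ M * N * ((M * N)⁻¹ * (∫⁻ x, h x) ^ 2) := by gcongr
    _ = _ := by rw [← mul_assoc, ENNReal.mul_inv_cancel hMN0 hMN, one_mul]

/-- The Prékopa-Leindler inequality on the line, at midpoints. -/
lemma lintegral_mul_le_sq_real {f g h : ℝ → ENNReal} (hf : Measurable f) (hg : Measurable g)
    (hh : Measurable h) (H : ∀ x y, f x * g y ≤ h ((2⁻¹ : ℝ) • (x + y)) ^ 2) :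
    (∫⁻ x, f x) * ∫⁻ x, g x ≤ (∫⁻ x, h x) ^ 2 := by
  have trunc : ∀ {f : ℝ → ENNReal}, Measurable f →
      ∫⁻ x, f x = ⨆ k : ℕ, ∫⁻ x, min (f x) k := by
    intro f hf
    rw [← lintegral_iSup (fun k => hf.min measurable_const)
      (fun k l hkl x => min_le_min le_rfl (by simpa using hkl))]
    congr 1; ext x
    rw [← inf_iSup_eq, ENNReal.iSup_natCast, inf_top_eq]
  have hscale : ∫⁻ z, h (2⁻¹ * z) = 2 * ∫⁻ z, h z := by
    rw [← lintegral_map (f := h) (g := fun z => (2⁻¹ : ℝ) * z) hh (by fun_prop),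
      Real.map_volume_mul_left (by norm_num)]
    simp
  rw [trunc hf, trunc hg, ENNReal.iSup_mul]
  refine iSup_le fun k => ?_
  rw [ENNReal.mul_iSup]
  refine iSup_le fun l => ?_
  have key := lintegral_mul_le_sq_of_bounded (f := fun x => min (f x) k) (g := fun x => min (g x) l)
    (h := fun z => h (2⁻¹ * z)) (hf.min measurable_const) (hg.min measurable_const)
    (hh.comp (measurable_const_mul _))
    (ne_top_of_le_ne_top (ENNReal.natCast_ne_top k) (iSup_le fun x => min_le_right _ _))
    (ne_top_of_le_ne_top (ENNReal.natCast_ne_top l) (iSup_le fun x => min_le_right _ _))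
    (fun x y => (mul_le_mul' (min_le_left _ _) (min_le_left _ _)).trans (H x y))
  rw [hscale, mul_pow] at key
  norm_num at key
  exact (ENNReal.mul_le_mul_iff_right (by norm_num) (by norm_num)).1 key

/-- The Prékopa-Leindler inequality on `ℝⁿ`, at midpoints. -/
lemma lintegral_mul_le_sq_pi {n : ℕ} : ∀ {f g h : (Fin n → ℝ) → ENNReal}, Measurable f →
    Measurable g → Measurable h →
    (∀ x y, f x * g y ≤ h ((2⁻¹ : ℝ) • (x + y)) ^ 2) →
    (∫⁻ x, f x) * ∫⁻ x, g x ≤ (∫⁻ x, h x) ^ 2 := by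
  induction n with
  | zero =>
    intro f g h hf hg hh H
    have hv : (volume : Measure (Fin 0 → ℝ)) = Measure.dirac (fun i => i.elim0) := by
      rw [volume_pi, Measure.pi_of_empty]
      congr 1
    rw [hv, lintegral_dirac, lintegral_dirac, lintegral_dirac]
    convert H (fun i => i.elim0) (fun i => i.elim0) using 3
  | succ n ih =>
    intro f g h hf hg hh H
    have e := (volume_preserving_piFinSuccAbove (fun _ : Fin (n + 1) => ℝ) 0).symm
    have hsplit : ∀ {f : (Fin (n + 1) → ℝ) → ENNReal}, Measurable f →
        ∫⁻ x, f x = ∫⁻ s : ℝ, ∫⁻ x : Fin n → ℝ, f (Fin.cons s x) := by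
      intro f hf
      rw [← e.lintegral_comp hf, Measure.volume_eq_prod, lintegral_prod]
      · simp [MeasurableEquiv.piFinSuccAbove, Fin.consEquiv]
      · exact (hf.comp e.measurable).aemeasurable
    have hmeas : Measurable fun p : ℝ × (Fin n → ℝ) => (Fin.cons p.1 p.2 : Fin (n + 1) → ℝ) := by
      refine measurable_pi_iff.2 fun i => Fin.cases ?_ (fun j => ?_) i
      · simpa using measurable_fst
      · simp only [Fin.cons_succ]; fun_prop
    rw [hsplit hf, hsplit hg, hsplit hh]
    refine lintegral_mul_le_sq_real (hf.comp hmeas).lintegral_prod_right'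
      (hg.comp hmeas).lintegral_prod_right' (hh.comp hmeas).lintegral_prod_right' fun s t => ?_
    have hs : ∀ s : ℝ, Measurable fun x : Fin n → ℝ => (Fin.cons s x : Fin (n + 1) → ℝ) := 
      fun s => hmeas.comp (measurable_const.prodMk measurable_id)
    refine ih (hf.comp (hs _)) (hg.comp (hs _)) (hh.comp (hs _)) fun x y => ?_
    convert H (Fin.cons s x) (Fin.cons t y) using 3
    ext i
    refine Fin.cases ?_ (fun j => ?_) i <;> simp [mul_add]

lemma withDensity_Ici_mul_le {n : ℕ} {ρ : (Fin n → ℝ) → ENNReal} (hm : AEMeasurable ρ volume)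
    (hρ : ∀ x y, ρ x * ρ y ≤ ρ ((2⁻¹ : ℝ) • (x + y)) ^ 2) (i : Fin n) (s t : ℝ) :
    (volume.withDensity ρ) {x | s ≤ x i} * (volume.withDensity ρ) {x | t ≤ x i} ≤
      (volume.withDensity ρ) {x | 2⁻¹ * (s + t) ≤ x i} ^ 2 := by
  have hmeas : ∀ s : ℝ, MeasurableSet {x : Fin n → ℝ | s ≤ x i} := fun s =>
    measurableSet_le measurable_const (measurable_pi_apply i)
  simp only [withDensity_apply _ (hmeas _), ← lintegral_indicator (hmeas _)]
  obtain ⟨f, hf, hfle, hfeq⟩ := exists_measurable_le_lintegral_eq volume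
    ({x : Fin n → ℝ | s ≤ x i}.indicator ρ)
  obtain ⟨g, hg, hgle, hgeq⟩ := exists_measurable_le_lintegral_eq volume
    ({x : Fin n → ℝ | t ≤ x i}.indicator ρ)
  obtain ⟨h, hh, hle, heq⟩ : ∃ h : (Fin n → ℝ) → ENNReal, Measurable h ∧ ρ ≤ h ∧ h =ᵐ[volume] ρ := by
    classical
    set N := toMeasurable volume {x | ρ x ≠ hm.mk ρ x}
    have hN : volume N = 0 := by rw [measure_toMeasurable]; exact hm.ae_eq_mk
    refine ⟨N.piecewise (fun _ => ⊤) (hm.mk ρ),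
      Measurable.piecewise (measurableSet_toMeasurable _ _) measurable_const hm.measurable_mk,
      fun x => ?_, ?_⟩
    · by_cases hx : x ∈ N
      · simp [hx]
      · have : ρ x = hm.mk ρ x := by
          by_contra hne
          exact hx (subset_toMeasurable _ _ hne)
        simp [hx, this]
    · filter_upwards [hm.ae_eq_mk, measure_eq_zero_iff_ae_notMem.1 hN] with x hx hx'
      simp [hx', hx]
  rw [hfeq, hgeq, show ∫⁻ x, {x : Fin n → ℝ | 2⁻¹ * (s + t) ≤ x i}.indicator ρ x =
    ∫⁻ x, {x : Fin n → ℝ | 2⁻¹ * (s + t) ≤ x i}.indicator h x from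
      lintegral_congr_ae (heq.symm.mono fun x hx => by
        by_cases hx' : x ∈ {x : Fin n → ℝ | 2⁻¹ * (s + t) ≤ x i} <;> simp [Set.indicator, hx])]
  refine lintegral_mul_le_sq_pi hf hg (hh.indicator (hmeas _)) fun x y => ?_
  refine (mul_le_mul' (hfle x) (hgle y)).trans ?_
  by_cases hx : s ≤ x i
  · by_cases hy : t ≤ y i
    · have hz : 2⁻¹ * (s + t) ≤ ((2⁻¹ : ℝ) • (x + y)) i := by
        simp only [Pi.smul_apply, Pi.add_apply, smul_eq_mul]; linarith
      rw [Set.indicator_of_mem (by exact hx), Set.indicator_of_mem (by exact hy),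
        Set.indicator_of_mem (by exact hz)]
      exact (hρ x y).trans (pow_le_pow_left' (hle _) 2)
    · rw [Set.indicator_of_notMem (s := {x : Fin n → ℝ | t ≤ x i}) (by exact hy)]; simp
  · rw [Set.indicator_of_notMem (s := {x : Fin n → ℝ | s ≤ x i}) (by exact hx)]; simp

lemma IsLogConcave.exists_density {n : ℕ} {η : Measure (Fin n → ℝ)} (h : IsLogConcave η) :
    ∃ ρ : (Fin n → ℝ) → ℝ, (∀ x, 0 ≤ ρ x) ∧ AEMeasurable ρ volume ∧
      η = volume.withDensity (fun x => ENNReal.ofReal (ρ x)) ∧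
      ∀ x y : Fin n → ℝ, ∀ l : ℝ, 0 ≤ l → l ≤ 1 →
        ρ x ^ l * ρ y ^ (1 - l) ≤ ρ (l • x + (1 - l) • y) := by
  obtain ⟨ρ, h0, hη, hc⟩ := h
  refine ⟨ρ, h0, ?_, hη, hc⟩
  have hconv : ∀ c : ℝ, Convex ℝ (ρ ⁻¹' Set.Ioi c) := by
    intro c x hx y hy a b ha hb hab
    have hx' : c < ρ x := hx
    have hy' : c < ρ y := hy
    have hm0 : 0 ≤ min (ρ x) (ρ y) := le_min (h0 x) (h0 y)
    obtain rfl : b = 1 - a := by linarith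
    refine lt_of_lt_of_le (lt_min hx' hy') (le_trans ?_ (hc x y a ha (by linarith)))
    calc min (ρ x) (ρ y) = min (ρ x) (ρ y) ^ a * min (ρ x) (ρ y) ^ (1 - a) := by
          rw [← Real.rpow_add' hm0 (by simp)]; simp
      _ ≤ _ := mul_le_mul (Real.rpow_le_rpow hm0 (min_le_left _ _) ha)
          (Real.rpow_le_rpow hm0 (min_le_right _ _) hb) (Real.rpow_nonneg hm0 _)
          (Real.rpow_nonneg (h0 x) _)
  have hmeas : Measurable (fun x : NullMeasurableSpace (Fin n → ℝ) volume => ρ x) :=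
    measurable_of_Ioi fun c => (hconv c).nullMeasurableSet volume
  exact NullMeasurable.aemeasurable fun s hs => hmeas hs

lemma IsLogConcave.measure_Ici_mul_le {n : ℕ} {η : Measure (Fin n → ℝ)} (h : IsLogConcave η)
    (i : Fin n) (s t : ℝ) :
    η {x | s ≤ x i} * η {x | t ≤ x i} ≤ η {x | 2⁻¹ * (s + t) ≤ x i} ^ 2 := by
  obtain ⟨ρ, h0, hm, rfl, hc⟩ := h.exists_density
  refine withDensity_Ici_mul_le hm.ennreal_ofReal (fun x y => ?_) i s t
  have h1 := hc x y 2⁻¹ (by norm_num) (by norm_num)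
  rw [← ENNReal.ofReal_mul (h0 x), ← ENNReal.ofReal_pow (h0 _)]
  refine ENNReal.ofReal_le_ofReal ?_
  rw [show (1 - 2⁻¹ : ℝ) = 2⁻¹ by norm_num, ← Real.mul_rpow (h0 _) (h0 _), ← smul_add] at h1
  have h2 := pow_le_pow_left₀ (Real.rpow_nonneg (mul_nonneg (h0 x) (h0 y)) _) h1 2
  rwa [← Real.rpow_natCast, ← Real.rpow_mul (mul_nonneg (h0 x) (h0 y)),
    show (2⁻¹ : ℝ) * (2 : ℕ) = 1 by norm_num, Real.rpow_one] at h2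

lemma IsHnInvariant.measurePreserving_sign {n : ℕ} {η : Measure (Fin n → ℝ)}
    (h : IsHnInvariant η) (i : Fin n) :
    MeasurePreserving (fun x : Fin n → ℝ => Function.update x i (-x i)) η η := by
  refine ⟨by fun_prop, ?_⟩
  convert h.2 (Function.update 1 i (-1)) (fun j => by
    by_cases hj : j = i
    · subst hj; simp
    · simp [hj]) using 2
  ext x j
  by_cases hj : j = i
  · subst hj; simp
  · simp [hj]

/-- Stretching one coordinate of an unconditional log-concave measure. -/
lemma measure_le_smul_map_update {n : ℕ} {η : Measure (Fin n → ℝ)}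
    (h : IsHnInvariant η) (hl : IsLogConcave η) (i : Fin n) {s : ℝ} (hs : 1 ≤ s) :
    η ≤ ENNReal.ofReal s • η.map (fun x => Function.update x i (s * x i)) := by
  obtain ⟨ρ, h0, hm, hη, hc⟩ := hl.exists_density
  have hs0 : 0 < s := by linarith
  set S : ℝ → (Fin n → ℝ) → (Fin n → ℝ) := fun s x => Function.update x i (s * x i) with hS
  have hSm : ∀ s, Measurable (S s) := fun s => by simp only [hS]; fun_prop
  have hSS : ∀ {a b : ℝ}, a * b = 1 → ∀ x, S a (S b x) = x := by
    intro a b hab x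
    simp [hS, ← mul_assoc, hab]
  have hvol : ∀ a : ℝ, a ≠ 0 →
      ENNReal.ofReal |a| • Measure.map (S a) volume = (volume : Measure (Fin n → ℝ)) := by
    intro a ha
    have := Real.smul_map_diagonal_volume_pi (D := Function.update (1 : Fin n → ℝ) i a) (by
      simp [Matrix.det_diagonal, Finset.prod_update_of_mem, ha])
    convert this using 2
    · simp [Matrix.det_diagonal, Finset.prod_update_of_mem]
    · congr 1
      ext x j
      by_cases hj : j = i
      · subst hj; simp [hS, Matrix.mulVec_diagonal]
      · simp [hS, hj, Matrix.mulVec_diagonal]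
  have hint : ∀ a : ℝ, a ≠ 0 → ∀ F : (Fin n → ℝ) → ENNReal,
      ENNReal.ofReal |a| * ∫⁻ x, F (S a x) = ∫⁻ x, F x := by
    intro a ha F
    have hemb : MeasurableEmbedding (S a) := MeasurableEquiv.measurableEmbedding
      { toFun := S a
        invFun := S a⁻¹
        left_inv := hSS (inv_mul_cancel₀ ha)
        right_inv := hSS (mul_inv_cancel₀ ha)
        measurable_toFun := hSm _
        measurable_invFun := hSm _ }
    rw [← hemb.lintegral_map, ← smul_eq_mul, ← lintegral_smul_measure, hvol a ha]
  have hset : ∀ a : ℝ, a ≠ 0 → ∀ A : Set (Fin n → ℝ), MeasurableSet A →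
      ENNReal.ofReal |a⁻¹| * ∫⁻ x in A, ENNReal.ofReal (ρ (S a⁻¹ x)) = η (S a ⁻¹' A) := by
    intro a ha A hA
    rw [hη, withDensity_apply _ (hSm a hA), ← lintegral_indicator (hSm a hA),
      ← hint a⁻¹ (inv_ne_zero ha), ← lintegral_indicator hA]
    congr 2
    ext x
    have hx : S a⁻¹ x ∈ S a ⁻¹' A ↔ x ∈ A := by
      rw [Set.mem_preimage, hSS (mul_inv_cancel₀ ha)]
    by_cases hxA : x ∈ A
    · rw [Set.indicator_of_mem hxA, Set.indicator_of_mem (hx.2 hxA)]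
    · rw [Set.indicator_of_notMem hxA, Set.indicator_of_notMem (mt hx.1 hxA)]
  have hSrefl : (S (-1)) = fun x => Function.update x i (-x i) := by
    ext x; simp [hS]
  have hrefl : (fun x => ρ (S (-1) x)) =ᵐ[volume] ρ := by
    have hq : Measure.QuasiMeasurePreserving (S (-1)) (volume : Measure (Fin n → ℝ)) volume := by
      refine ⟨hSm _, ?_⟩
      have := hvol (-1) (by norm_num)
      simp only [abs_neg, abs_one, ENNReal.ofReal_one, one_smul] at this
      rw [this]
    have hm' : AEMeasurable (fun x => ρ (S (-1) x)) volume :=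
      hm.comp_quasiMeasurePreserving hq
    have heq : volume.withDensity (fun x => ENNReal.ofReal (ρ (S (-1) x))) =
        volume.withDensity (fun x => ENNReal.ofReal (ρ x)) := by
      rw [← hη]
      ext A hA
      have h1 := hset (-1) (by norm_num) A hA
      rw [hSrefl, (h.measurePreserving_sign i).measure_preimage hA.nullMeasurableSet] at h1
      rw [withDensity_apply _ hA, ← h1]
      norm_num
    rw [withDensity_eq_iff_of_sigmaFinite hm'.ennreal_ofReal hm.ennreal_ofReal] at heq
    filter_upwards [heq] with x hx
    exact (ENNReal.ofReal_eq_ofReal_iff (h0 _) (h0 _)).1 hx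
  have hmono : ∀ᵐ x, ρ x ≤ ρ (S s⁻¹ x) := by
    filter_upwards [hrefl] with x hx
    have h1 := hc x (S (-1) x) ((1 + s⁻¹) / 2) (by positivity) (by
      have := inv_le_one_of_one_le₀ hs
      linarith)
    rw [hx, ← Real.rpow_add' (h0 x) (by norm_num)] at h1
    norm_num at h1
    convert h1 using 2
    ext j
    by_cases hj : j = i
    · subst hj; simp [hS]; ring
    · simp [hS, hj]; ring
  refine Measure.le_iff.2 fun A hA => ?_
  rw [Measure.smul_apply, Measure.map_apply (hSm s) hA, smul_eq_mul, ← hset s hs0.ne' A hA,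
    ← mul_assoc, ← ENNReal.ofReal_mul hs0.le, abs_of_pos (inv_pos.2 hs0), mul_inv_cancel₀ hs0.ne',
    ENNReal.ofReal_one, one_mul]
  rw [hη, withDensity_apply _ hA]
  exact lintegral_mono_ae (ae_restrict_of_ae (hmono.mono fun x hx => ENNReal.ofReal_le_ofReal hx))

lemma measure_le_abs_eq {n : ℕ} {η : Measure (Fin n → ℝ)} (h : IsHnInvariant η) (i : Fin n)
    (t : ℝ) : η {x | x i ≤ -t} = η {x | t ≤ x i} := by
  have hm : MeasurableSet {x : Fin n → ℝ | t ≤ x i} :=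
    measurableSet_le measurable_const (measurable_pi_apply i)
  rw [← (h.measurePreserving_sign i).measure_preimage hm.nullMeasurableSet]
  congr 1
  ext x
  simp [le_neg]

lemma lintegral_sq_eq_one {n : ℕ} {η : Measure (Fin n → ℝ)} (hi : IsIsotropic η) (i : Fin n) :
    ∫⁻ x, ENNReal.ofReal (x i ^ 2) ∂η = 1 := by
  have h1 : ∫ x, x i ^ 2 ∂η = 1 := by simpa [sq] using hi.2 i i
  have h2 : Integrable (fun x : Fin n → ℝ => x i ^ 2) η := by
    by_contra hc
    rw [integral_undef hc] at h1
    exact zero_ne_one h1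
  rw [← ofReal_integral_eq_lintegral_ofReal h2 (Filter.Eventually.of_forall fun x => sq_nonneg _),
    h1, ENNReal.ofReal_one]

/-- Exponential tails of the coordinates. -/
lemma measure_two_mul_le {n : ℕ} {η : Measure (Fin n → ℝ)} [IsProbabilityMeasure η]
    (h : IsHnInvariant η) (hi : IsIsotropic η) (hl : IsLogConcave η) (i : Fin n) (k : ℕ) :
    4 ^ k * η {x | 2 * (k : ℝ) ≤ x i} ≤ 1 := by
  set U : ℕ → ENNReal := fun k => η {x | 2 * (k : ℝ) ≤ x i} with hU
  have hstep : ∀ k, U k * U (k + 2) ≤ U (k + 1) ^ 2 := by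
    intro k
    have := hl.measure_Ici_mul_le i (2 * (k : ℝ)) (2 * ((k + 2 : ℕ) : ℝ))
    rwa [show 2⁻¹ * (2 * (k : ℝ) + 2 * ((k + 2 : ℕ) : ℝ)) = 2 * ((k + 1 : ℕ) : ℝ) by
      push_cast; ring] at this
  have hanti : ∀ k, U (k + 1) ≤ U k := fun k => measure_mono fun x hx => by
    simp only [Set.mem_ofPred_eq] at hx ⊢
    push_cast at hx
    linarith
  have hfin : ∀ k, U k ≠ ⊤ := fun k => measure_ne_top _ _
  have h0 : 1 ≤ 2 * U 0 := by
    calc (1 : ENNReal) = η Set.univ := measure_univ.symm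
      _ ≤ η ({x | (0 : ℝ) ≤ x i} ∪ {x | x i ≤ -(0 : ℝ)}) := measure_mono fun x _ => by
          rcases le_total 0 (x i) with hx | hx
          · exact Or.inl hx
          · exact Or.inr (by simpa using hx)
      _ ≤ _ := measure_union_le _ _
      _ = 2 * U 0 := by rw [measure_le_abs_eq h]; simp [hU, two_mul]
  have h1 : 8 * U 1 ≤ 1 := by
    have hd : Disjoint {x : Fin n → ℝ | (2 : ℝ) ≤ x i} {x | x i ≤ -(2 : ℝ)} := by
      rw [Set.disjoint_left]
      intro x hx hx'
      simp only [Set.mem_ofPred_eq] at hx hx'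
      linarith
    have hU2 : η ({x | (2 : ℝ) ≤ x i} ∪ {x | x i ≤ -(2 : ℝ)}) = 2 * U 1 := by
      rw [measure_union hd (measurableSet_le (measurable_pi_apply i) measurable_const),
        measure_le_abs_eq h, ← two_mul]
      simp [hU]
    calc 8 * U 1 = 4 * η ({x | (2 : ℝ) ≤ x i} ∪ {x | x i ≤ -(2 : ℝ)}) := by
          rw [hU2, ← mul_assoc]; norm_num
      _ ≤ 4 * η {x | 4 ≤ ENNReal.ofReal (x i ^ 2)} := by
          gcongr
          rintro x hx
          simp only [Set.mem_union, Set.mem_ofPred_eq] at hx ⊢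
          rw [show (4 : ENNReal) = ENNReal.ofReal 4 by norm_num]
          refine ENNReal.ofReal_le_ofReal ?_
          rcases hx with hx | hx <;> nlinarith
      _ ≤ ∫⁻ x, ENNReal.ofReal (x i ^ 2) ∂η := mul_meas_ge_le_lintegral (by fun_prop) _
      _ = 1 := lintegral_sq_eq_one hi i
  have hratio : ∀ k, 4 * U (k + 1) ≤ U k := by
    intro k
    induction k with
    | zero =>
      have : 2 * (4 * U 1) ≤ 2 * U 0 := by
        calc 2 * (4 * U 1) = 8 * U 1 := by rw [← mul_assoc]; norm_num
          _ ≤ _ := h1.trans h0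
      exact (ENNReal.mul_le_mul_iff_right (by norm_num) (by norm_num)).1 this
    | succ k ih =>
      by_cases hz : U (k + 1) = 0
      · have : U (k + 1 + 1) = 0 := le_antisymm (hz ▸ hanti (k + 1)) zero_le
        simp [this]
      · refine (ENNReal.mul_le_mul_iff_right hz (hfin _)).1 ?_
        calc U (k + 1) * (4 * U (k + 1 + 1)) = 4 * U (k + 1) * U (k + 2) := by ring
          _ ≤ U k * U (k + 2) := by gcongr
          _ ≤ U (k + 1) * U (k + 1) := by rw [← sq]; exact hstep k
  have hfinal : ∀ k, 4 ^ k * U k ≤ 1 := by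
    intro k
    induction k with
    | zero => simpa using prob_le_one
    | succ k ih =>
      calc 4 ^ (k + 1) * U (k + 1) = 4 ^ k * (4 * U (k + 1)) := by ring
        _ ≤ 4 ^ k * U k := by gcongr; exact hratio k
        _ ≤ 1 := ih
  exact hfinal k

/-- An upper bound for the absolute moments of the coordinates. -/
def momentBound (p : ℕ) : ENNReal :=
  ∑' j : ℕ, ENNReal.ofReal ((2 * ((j : ℝ) + 1)) ^ p * (2 * (1 / 4) ^ j))

lemma momentBound_ne_top (p : ℕ) : momentBound p ≠ ⊤ := by
  refine Summable.tsum_ofReal_ne_top ?_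
  have h := summable_pow_mul_geometric_of_norm_lt_one p (r := (1 / 4 : ℝ)) (by norm_num)
  have h' := ((summable_nat_add_iff 1).2 h).mul_left (2 ^ p * 2 * 4)
  refine h'.congr fun j => ?_
  push_cast
  rw [mul_pow, pow_succ]
  ring

lemma lintegral_abs_pow_le {n : ℕ} {η : Measure (Fin n → ℝ)} [IsProbabilityMeasure η]
    (h : IsHnInvariant η) (hi : IsIsotropic η) (hl : IsLogConcave η) (i : Fin n) (p : ℕ) :
    ∫⁻ x, ENNReal.ofReal (|x i| ^ p) ∂η ≤ momentBound p := by
  have hm : ∀ j : ℕ, MeasurableSet {x : Fin n → ℝ | 2 * (j : ℝ) ≤ |x i|} := fun j =>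
    measurableSet_le measurable_const (measurable_pi_apply i).abs
  calc ∫⁻ x, ENNReal.ofReal (|x i| ^ p) ∂η
      ≤ ∫⁻ x, ∑' j : ℕ, {x : Fin n → ℝ | 2 * (j : ℝ) ≤ |x i|}.indicator
          (fun _ => ENNReal.ofReal ((2 * ((j : ℝ) + 1)) ^ p)) x ∂η := by
        refine lintegral_mono fun x => ?_
        refine le_trans ?_ (ENNReal.le_tsum ⌊|x i| / 2⌋₊)
        have h1 : 2 * (⌊|x i| / 2⌋₊ : ℝ) ≤ |x i| := by
          have := Nat.floor_le (a := |x i| / 2) (by positivity)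
          linarith
        have h2 := Nat.lt_floor_add_one (|x i| / 2)
        rw [Set.indicator_of_mem (by exact h1)]
        refine ENNReal.ofReal_le_ofReal (pow_le_pow_left₀ (abs_nonneg _) ?_ _)
        linarith
    _ = ∑' j : ℕ, ENNReal.ofReal ((2 * ((j : ℝ) + 1)) ^ p) *
          η {x : Fin n → ℝ | 2 * (j : ℝ) ≤ |x i|} := by
        rw [lintegral_tsum fun j => (measurable_const.indicator (hm j)).aemeasurable]
        simp only [lintegral_indicator_const (hm _)]
    _ ≤ momentBound p := by
        refine ENNReal.tsum_le_tsum fun j => ?_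
        rw [ENNReal.ofReal_mul (by positivity)]
        gcongr
        have h4 : η {x | 2 * (j : ℝ) ≤ x i} ≤ ENNReal.ofReal ((1 / 4) ^ j) := by
          have h5 := measure_two_mul_le h hi hl i j
          rw [mul_comm] at h5
          have := ENNReal.le_div_iff_mul_le (a := η {x | 2 * (j : ℝ) ≤ x i}) (b := 4 ^ j) (c := 1)
            (Or.inl (by positivity)) (Or.inl (by finiteness))
          rw [ENNReal.ofReal_pow (by norm_num), ENNReal.ofReal_div_of_pos (by norm_num)]
          refine (this.2 h5).trans_eq ?_
          simp [ENNReal.inv_pow]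
        calc _ ≤ η ({x | 2 * (j : ℝ) ≤ x i} ∪ {x | x i ≤ -(2 * (j : ℝ))}) :=
              measure_mono fun x hx => by
                rcases le_abs.1 (by exact hx : 2 * (j : ℝ) ≤ |x i|) with h | h
                · exact Or.inl h
                · exact Or.inr (by simp only [Set.mem_ofPred_eq]; linarith)
          _ ≤ _ := measure_union_le _ _
          _ ≤ _ := by
              rw [measure_le_abs_eq h, ← two_mul, ENNReal.ofReal_mul (by norm_num)]
              gcongr
              norm_num

lemma memLp_eval {n : ℕ} {η : Measure (Fin n → ℝ)} [IsProbabilityMeasure η]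
    (h : IsHnInvariant η) (hi : IsIsotropic η) (hl : IsLogConcave η)
    (P : MvPolynomial (Fin n) ℝ) :
    ∀ p : ℕ, p ≠ 0 → MemLp (fun x => MvPolynomial.eval x P) p η := by
  have hX : ∀ i : Fin n, ∀ p : ℕ, p ≠ 0 → MemLp (fun x : Fin n → ℝ => x i) p η := by
    intro i p hp
    refine ⟨(measurable_pi_apply i).aestronglyMeasurable, ?_⟩
    rw [eLpNorm_lt_top_iff_lintegral_rpow_enorm_lt_top (by simpa using hp) (by simp)]
    refine lt_of_le_of_lt ?_ (momentBound_ne_top p).lt_top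
    refine le_trans (le_of_eq ?_) (lintegral_abs_pow_le h hi hl i p)
    refine lintegral_congr fun x => ?_
    rw [ENNReal.toReal_natCast, ENNReal.rpow_natCast, ← ofReal_norm, Real.norm_eq_abs,
      ENNReal.ofReal_pow (abs_nonneg _)]
  induction P using MvPolynomial.induction_on with
  | C a => intro p _; simpa using memLp_const a
  | add P Q hP hQ =>
    intro p hp
    simp only [map_add]
    exact (hP p hp).add (hQ p hp)
  | mul_X P i hP =>
    intro p hp
    have : ENNReal.HolderTriple ((2 * p : ℕ) : ENNReal) ((2 * p : ℕ) : ENNReal) (p : ENNReal) := by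
      refine ⟨?_⟩
      push_cast
      rw [← two_mul, ENNReal.mul_inv (by norm_num) (by norm_num), ← mul_assoc,
        ENNReal.mul_inv_cancel (by norm_num) (by norm_num), one_mul]
    have := (hX i (2 * p) (by omega)).mul (hP (2 * p) (by omega)) (r := p)
    simp only [map_mul, MvPolynomial.eval_X]
    exact this

lemma integrable_eval {n : ℕ} {η : Measure (Fin n → ℝ)} [IsProbabilityMeasure η]
    (h : IsHnInvariant η) (hi : IsIsotropic η) (hl : IsLogConcave η)
    (P : MvPolynomial (Fin n) ℝ) : Integrable (fun x => MvPolynomial.eval x P) η := by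
  have := memLp_eval h hi hl P 1 one_ne_zero
  rwa [Nat.cast_one, memLp_one_iff_integrable] at this

lemma MvPolynomial.eval_update_mul_monomial {n : ℕ} (x : Fin n → ℝ) (i : Fin n) (s : ℝ)
    (I : Fin n →₀ ℕ) (a : ℝ) :
    MvPolynomial.eval (Function.update x i (s * x i)) (MvPolynomial.monomial I a) =
      s ^ I i * MvPolynomial.eval x (MvPolynomial.monomial I a) := by
  have h : ∀ v, Function.update x i (s * x i) v = (if v = i then s else 1) * x v := by
    intro v
    by_cases hv : v = i
    · subst hv; simp
    · simp [hv]
  simp only [MvPolynomial.eval_monomial, h]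
  rw [Finsupp.prod_fintype _ _ (by simp), Finsupp.prod_fintype _ _ (by simp)]
  simp only [mul_pow, Finset.prod_mul_distrib, ite_pow, one_pow, Finset.prod_ite_eq',
    Finset.mem_univ, if_true]
  ring

/-- The properties of the moment functional `P ↦ ∫ P dη` used in the proof. -/
structure IsMomentFunctional {n : ℕ} (K : ℝ) (L : MvPolynomial (Fin n) ℝ →ₗ[ℝ] ℝ) : Prop where
  nonneg : ∀ P, (∀ x, 0 ≤ MvPolynomial.eval x P) → 0 ≤ L P
  rename : ∀ (σ : Equiv.Perm (Fin n)) P, L (MvPolynomial.rename σ P) = L P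
  odd : ∀ (I : Fin n →₀ ℕ) (v : Fin n), Odd (I v) → L (MvPolynomial.monomial I 1) = 0
  one : L 1 = 1
  sq : ∀ i, L (MvPolynomial.X i ^ 2) = 1
  sixth_le : ∀ i, L (MvPolynomial.X i ^ 6) ≤ K
  stretch : ∀ (i : Fin n) (G : MvPolynomial (Fin n) ℝ), (∀ x, 0 ≤ MvPolynomial.eval x G) →
    0 ≤ L (G + MvPolynomial.X i * MvPolynomial.pderiv i G)

lemma exists_isMomentFunctional {n : ℕ} {η : Measure (Fin n → ℝ)} [IsProbabilityMeasure η]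
    (h : IsHnInvariant η) (hi : IsIsotropic η) (hl : IsLogConcave η) :
    ∃ L : MvPolynomial (Fin n) ℝ →ₗ[ℝ] ℝ, IsMomentFunctional (momentBound 6).toReal L ∧
      ∀ P, L P = ∫ x, MvPolynomial.eval x P ∂η := by
  have hint := integrable_eval h hi hl
  set L : MvPolynomial (Fin n) ℝ →ₗ[ℝ] ℝ :=
    { toFun := fun P => ∫ x, MvPolynomial.eval x P ∂η
      map_add' := fun P Q => by
        simp only [map_add]
        exact integral_add (hint P) (hint Q)
      map_smul' := fun c P => by
        simp only [MvPolynomial.smul_eval, integral_const_mul, RingHom.id_apply, smul_eq_mul] }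
    with hL
  have hL' : ∀ P, L P = ∫ x, MvPolynomial.eval x P ∂η := fun P => rfl
  have hmeas : ∀ P : MvPolynomial (Fin n) ℝ, Measurable fun x : Fin n → ℝ => MvPolynomial.eval x P :=
    fun P => P.continuous_eval.measurable
  refine ⟨L, ⟨fun P hP => ?_, fun σ P => ?_, fun I v hv => ?_, ?_, fun i => ?_, fun i => ?_,
    fun i G hG => ?_⟩, hL'⟩
  · exact integral_nonneg hP
  · rw [hL', hL']
    simp only [MvPolynomial.eval_rename]
    conv_rhs => rw [← h.1 σ]
    have hσ : Measurable fun x : Fin n → ℝ => x ∘ σ :=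
      measurable_pi_iff.2 fun i => measurable_pi_apply (σ i)
    rw [integral_map hσ.aemeasurable (hmeas P).aestronglyMeasurable]
  · have h1 : L (MvPolynomial.monomial I 1) = -L (MvPolynomial.monomial I 1) := by
      rw [hL']
      conv_lhs => rw [← (h.measurePreserving_sign v).map_eq]
      rw [integral_map (by fun_prop) (hmeas _).aestronglyMeasurable, ← integral_neg]
      refine integral_congr_ae (Filter.Eventually.of_forall fun x => ?_)
      have := MvPolynomial.eval_update_mul_monomial x v (-1) I 1
      simpa [hv.neg_one_pow] using this
    linarith
  · simp [hL']
  · simpa [hL', sq] using hi.2 i i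
  · rw [hL', integral_eq_lintegral_of_nonneg_ae
      (Filter.Eventually.of_forall fun x => by simp only [map_pow, MvPolynomial.eval_X]; positivity)
      (hmeas _).aestronglyMeasurable]
    refine ENNReal.toReal_mono (momentBound_ne_top 6) ?_
    convert lintegral_abs_pow_le h hi hl i 6 using 4 with x
    simp [pow_abs, abs_of_nonneg (Even.pow_nonneg (by decide : Even 6) (x i))]
  · have hderiv : ∀ G : MvPolynomial (Fin n) ℝ, HasDerivAt
        (fun s : ℝ => s * ∫ x, MvPolynomial.eval (Function.update x i (s * x i)) G ∂η)
        (L (G + MvPolynomial.X i * MvPolynomial.pderiv i G)) 1 ∧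
        ∀ s : ℝ, Integrable (fun x => MvPolynomial.eval (Function.update x i (s * x i)) G) η := by
      intro G
      induction G using MvPolynomial.induction_on' with
      | monomial I a =>
        simp only [MvPolynomial.eval_update_mul_monomial, integral_const_mul,
          MvPolynomial.X_mul_pderiv_monomial, map_add, map_nsmul, ← hL']
        refine ⟨?_, fun s => (hint _).const_mul _⟩
        have := ((hasDerivAt_pow (I i + 1) (1 : ℝ)).mul_const (L (MvPolynomial.monomial I a)))
        rw [show (fun s : ℝ => s * (s ^ I i * L (MvPolynomial.monomial I a))) =
          fun s => s ^ (I i + 1) * L (MvPolynomial.monomial I a) by ext s; ring]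
        refine this.congr_deriv ?_
        rw [nsmul_eq_mul]; push_cast; ring
      | add P Q hP hQ =>
        refine ⟨?_, fun s => by simp only [map_add]; exact (hP.2 s).add (hQ.2 s)⟩
        rw [show (fun s : ℝ => s * ∫ x, MvPolynomial.eval (Function.update x i (s * x i)) (P + Q) ∂η)
          = fun s => s * (∫ x, MvPolynomial.eval (Function.update x i (s * x i)) P ∂η) +
            s * ∫ x, MvPolynomial.eval (Function.update x i (s * x i)) Q ∂η by
          ext s
          simp only [map_add]
          rw [integral_add (hP.2 s) (hQ.2 s), mul_add]]
        refine (hP.1.add hQ.1).congr_deriv ?_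
        rw [← map_add, map_add (MvPolynomial.pderiv i)]
        congr 1; ring
    have hmono : ∀ s : ℝ, 1 ≤ s → ∫ x, MvPolynomial.eval x G ∂η ≤
        s * ∫ x, MvPolynomial.eval (Function.update x i (s * x i)) G ∂η := by
      intro s hs
      have hSm : Measurable fun x : Fin n → ℝ => Function.update x i (s * x i) := by fun_prop
      have h1 := integral_mono_measure (f := fun x => MvPolynomial.eval x G)
        (measure_le_smul_map_update h hl i hs)
        (Filter.Eventually.of_forall hG)
        (((integrable_map_measure (hmeas G).aestronglyMeasurable hSm.aemeasurable).2
          ((hderiv G).2 s)).smul_measure ENNReal.ofReal_ne_top)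
      rwa [integral_smul_measure, integral_map hSm.aemeasurable (hmeas G).aestronglyMeasurable,
        ENNReal.toReal_ofReal (by linarith), smul_eq_mul] at h1
    have htend := ((hderiv G).1.hasDerivWithinAt (s := Set.Ioi 1))
    rw [hasDerivWithinAt_iff_tendsto_slope' (by simp)] at htend
    refine ge_of_tendsto htend ?_
    filter_upwards [self_mem_nhdsWithin] with s hs
    have hs' : (1 : ℝ) < s := hs
    rw [slope_def_field]
    refine div_nonneg ?_ (by linarith)
    have := hmono s hs'.le
    simpa using this

open MvPolynomial in
/-- The even moments of degree at most six of a coordinate-permutation-invariant functional. -/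
structure HasEvenMoments {n : ℕ} (L : MvPolynomial (Fin n) ℝ →ₗ[ℝ] ℝ)
    (m6 m4 m22 m42 m222 : ℝ) : Prop where
  six : ∀ i, L (X i ^ 6) = m6
  four : ∀ i, L (X i ^ 4) = m4
  two_two : ∀ i j, i ≠ j → L (X i ^ 2 * X j ^ 2) = m22
  four_two : ∀ i j, i ≠ j → L (X i ^ 4 * X j ^ 2) = m42
  two_two_two : ∀ i j k, i ≠ j → i ≠ k → j ≠ k → L (X i ^ 2 * X j ^ 2 * X k ^ 2) = m222

/-- The quadratic form `∑ cⱼ Xⱼ²`. -/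
def diagForm {n : ℕ} (c : Fin n → ℝ) : MvPolynomial (Fin n) ℝ :=
  ∑ j, c j • MvPolynomial.X j ^ 2

lemma X_mul_pderiv_diagForm {n : ℕ} (c : Fin n → ℝ) (i : Fin n) :
    MvPolynomial.X i * MvPolynomial.pderiv i (diagForm c) =
      (2 * c i) • (MvPolynomial.X i ^ 2 : MvPolynomial (Fin n) ℝ) := by
  classical
  have h : ∀ j, MvPolynomial.pderiv i (c j • (MvPolynomial.X j ^ 2 : MvPolynomial (Fin n) ℝ)) =
      if j = i then (2 * c i) • MvPolynomial.X i else 0 := by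
    intro j
    rw [Derivation.map_smul, MvPolynomial.pderiv_pow, MvPolynomial.pderiv_X]
    by_cases hj : j = i
    · subst hj
      simp only [Pi.single_eq_same, if_true, MvPolynomial.smul_eq_C_mul, map_mul]
      push_cast
      simp only [map_ofNat]
      ring
    · simp [hj]
  rw [diagForm, map_sum, Finset.sum_congr rfl fun j _ => h j, Finset.sum_ite_eq' Finset.univ i]
  simp only [Finset.mem_univ, if_true, mul_smul_comm]
  rw [sq]

lemma diagForm_add_single {n : ℕ} (c : Fin n → ℝ) (i : Fin n) (s : ℝ) :
    diagForm (c + Pi.single i s) = diagForm c + s • MvPolynomial.X i ^ 2 := by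
  simp [diagForm, add_smul, Finset.sum_add_distrib, Pi.single_apply, ite_smul]

lemma IsMomentFunctional.map_eq_of_embedding {n : ℕ} {K : ℝ} {L : MvPolynomial (Fin n) ℝ →ₗ[ℝ] ℝ}
    (h : IsMomentFunctional K L) (x y : Fin 3 ↪ Fin n) (a b c : ℕ) :
    L (MvPolynomial.X (x 0) ^ a * MvPolynomial.X (x 1) ^ b * MvPolynomial.X (x 2) ^ c) =
      L (MvPolynomial.X (y 0) ^ a * MvPolynomial.X (y 1) ^ b * MvPolynomial.X (y 2) ^ c) := by
  obtain ⟨σ, hσ⟩ := MulAction.isMultiplyPretransitive_iff.1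
    (Equiv.Perm.isMultiplyPretransitive (Fin n) 3) x y
  have hσ' : ∀ i, σ (x i) = y i := fun i => by rw [← hσ]; rfl
  rw [← h.rename σ]
  simp [hσ']

lemma Fin.exists_embedding_three {n : ℕ} {i j k : Fin n} (hij : i ≠ j) (hik : i ≠ k) (hjk : j ≠ k) :
    ∃ x : Fin 3 ↪ Fin n, x 0 = i ∧ x 1 = j ∧ x 2 = k := by
  refine ⟨⟨![i, j, k], ?_⟩, rfl, rfl, rfl⟩
  intro a b
  fin_cases a <;> fin_cases b <;> simp [hij, hik, hjk, hij.symm, hik.symm, hjk.symm]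

lemma Fin.exists_ne_ne {n : ℕ} (hn : 3 ≤ n) (i j : Fin n) : ∃ k, i ≠ k ∧ j ≠ k := by
  have : ({i, j} : Finset (Fin n)).card < (Finset.univ : Finset (Fin n)).card := by
    have := Finset.card_le_two (a := i) (b := j)
    rw [Finset.card_univ, Fintype.card_fin]
    omega
  obtain ⟨k, -, hk⟩ := Finset.exists_mem_notMem_of_card_lt_card this
  simp only [Finset.mem_insert, Finset.mem_singleton, not_or] at hk
  exact ⟨k, Ne.symm hk.1, Ne.symm hk.2⟩

lemma IsMomentFunctional.exists_hasEvenMoments {n : ℕ} {K : ℝ}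
    {L : MvPolynomial (Fin n) ℝ →ₗ[ℝ] ℝ} (h : IsMomentFunctional K L) (hn : 3 ≤ n) :
    ∃ m6 m4 m22 m42 m222, HasEvenMoments L m6 m4 m22 m42 m222 := by
  set z : Fin 3 ↪ Fin n := Fin.castLEEmb hn
  have hf := fun a b c x => h.map_eq_of_embedding x z a b c
  refine ⟨L (MvPolynomial.X (z 0) ^ 6), L (MvPolynomial.X (z 0) ^ 4),
    L (MvPolynomial.X (z 0) ^ 2 * MvPolynomial.X (z 1) ^ 2),
    L (MvPolynomial.X (z 0) ^ 4 * MvPolynomial.X (z 1) ^ 2),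
    L (MvPolynomial.X (z 0) ^ 2 * MvPolynomial.X (z 1) ^ 2 * MvPolynomial.X (z 2) ^ 2),
    ⟨fun i => ?_, fun i => ?_, fun i j hij => ?_, fun i j hij => ?_,
      fun i j k hij hik hjk => ?_⟩⟩
  · obtain ⟨j, hij, -⟩ := Fin.exists_ne_ne hn i i
    obtain ⟨k, hik, hjk⟩ := Fin.exists_ne_ne hn i j
    obtain ⟨x, rfl, rfl, rfl⟩ := Fin.exists_embedding_three hij hik hjk
    simpa using hf 6 0 0 x
  · obtain ⟨j, hij, -⟩ := Fin.exists_ne_ne hn i i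
    obtain ⟨k, hik, hjk⟩ := Fin.exists_ne_ne hn i j
    obtain ⟨x, rfl, rfl, rfl⟩ := Fin.exists_embedding_three hij hik hjk
    simpa using hf 4 0 0 x
  · obtain ⟨k, hik, hjk⟩ := Fin.exists_ne_ne hn i j
    obtain ⟨x, rfl, rfl, rfl⟩ := Fin.exists_embedding_three hij hik hjk
    simpa using hf 2 2 0 x
  · obtain ⟨k, hik, hjk⟩ := Fin.exists_ne_ne hn i j
    obtain ⟨x, rfl, rfl, rfl⟩ := Fin.exists_embedding_three hij hik hjk
    simpa using hf 4 2 0 x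
  · obtain ⟨x, rfl, rfl, rfl⟩ := Fin.exists_embedding_three hij hik hjk
    exact hf 2 2 2 x

namespace HasEvenMoments

open MvPolynomial

variable {n : ℕ} {L : MvPolynomial (Fin n) ℝ →ₗ[ℝ] ℝ} {m6 m4 m22 m42 m222 : ℝ}

lemma map_sq_mul_sq (h : HasEvenMoments L m6 m4 m22 m42 m222) (i j : Fin n) :
    L (X i ^ 2 * X j ^ 2) = m22 + if j = i then m4 - m22 else 0 := by
  by_cases hij : j = i
  · subst hij
    rw [← pow_add, h.four]; simp
  · rw [h.two_two i j (Ne.symm hij)]; simp [hij]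

lemma map_pow_four_mul_sq (h : HasEvenMoments L m6 m4 m22 m42 m222) (i j : Fin n) :
    L (X i ^ 4 * X j ^ 2) = m42 + if j = i then m6 - m42 else 0 := by
  by_cases hij : j = i
  · subst hij
    rw [← pow_add, h.six]; simp
  · rw [h.four_two i j (Ne.symm hij)]; simp [hij]

lemma map_sq_mul_sq_mul_sq (h : HasEvenMoments L m6 m4 m22 m42 m222) (i j k : Fin n) :
    L (X i ^ 2 * X j ^ 2 * X k ^ 2) = m222 + (if k = j then m42 - m222 else 0) +
      (if j = i then m42 - m222 else 0) + (if k = i then m42 - m222 else 0) +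
      if j = i then (if k = i then m6 - 3 * m42 + 2 * m222 else 0) else 0 := by
  by_cases hij : j = i
  · subst hij
    rw [← pow_add, h.map_pow_four_mul_sq]
    by_cases hk : k = j
    · simp [hk]; ring
    · simp [hk]
  · by_cases hk : k = i
    · subst hk
      rw [mul_right_comm, ← pow_add, h.four_two k j (Ne.symm hij)]
      simp [hij, Ne.symm hij]
    · by_cases hjk : k = j
      · subst hjk
        rw [mul_assoc, ← pow_add, mul_comm, h.four_two k i hij]
        simp [hij]
      · rw [h.two_two_two i j k (Ne.symm hij) (Ne.symm hk) (Ne.symm hjk)]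
        simp [hij, hk, hjk]

lemma map_sq_mul_diagForm (h : HasEvenMoments L m6 m4 m22 m42 m222) (i : Fin n) (c : Fin n → ℝ) :
    L (X i ^ 2 * diagForm c) = m22 * ∑ j, c j + (m4 - m22) * c i := by
  simp only [diagForm, Finset.mul_sum, mul_smul_comm, map_sum, map_smul, h.map_sq_mul_sq,
    smul_eq_mul, mul_add, mul_ite, mul_zero, Finset.sum_add_distrib, Finset.sum_ite_eq',
    Finset.mem_univ, if_true]
  simp only [mul_comm]

lemma map_pow_four_mul_diagForm (h : HasEvenMoments L m6 m4 m22 m42 m222) (i : Fin n)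
    (c : Fin n → ℝ) : L (X i ^ 4 * diagForm c) = m42 * ∑ j, c j + (m6 - m42) * c i := by
  simp only [diagForm, Finset.mul_sum, mul_smul_comm, map_sum, map_smul, h.map_pow_four_mul_sq,
    smul_eq_mul, mul_add, mul_ite, mul_zero, Finset.sum_add_distrib, Finset.sum_ite_eq',
    Finset.mem_univ, if_true]
  simp only [mul_comm]

lemma map_diagForm_sq (h : HasEvenMoments L m6 m4 m22 m42 m222) (c : Fin n → ℝ) :
    L (diagForm c ^ 2) = m22 * (∑ j, c j) ^ 2 + (m4 - m22) * ∑ j, c j ^ 2 := by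
  rw [sq, diagForm, Finset.sum_mul, map_sum]
  simp only [smul_mul_assoc, map_smul]
  rw [← diagForm]
  simp only [h.map_sq_mul_diagForm, smul_eq_mul, mul_add, Finset.sum_add_distrib,
    ← Finset.sum_mul]
  rw [Finset.sum_congr rfl fun (j : Fin n) _ => show c j * ((m4 - m22) * c j) =
    (m4 - m22) * c j ^ 2 by ring, ← Finset.mul_sum]
  ring

lemma map_sq_mul_diagForm_sq (h : HasEvenMoments L m6 m4 m22 m42 m222) (i : Fin n)
    (c : Fin n → ℝ) :
    L (X i ^ 2 * diagForm c ^ 2) = m222 * (∑ j, c j) ^ 2 + (m42 - m222) * ∑ j, c j ^ 2 +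
      2 * (m42 - m222) * c i * ∑ j, c j + (m6 - 3 * m42 + 2 * m222) * c i ^ 2 := by
  have h1 : ∀ j, L (X i ^ 2 * X j ^ 2 * diagForm c) = m222 * ∑ k, c k + (m42 - m222) * c j +
      (m42 - m222) * c i + if j = i then
        (m42 - m222) * ∑ k, c k + (m6 - 3 * m42 + 2 * m222) * c i else 0 := by
    intro j
    simp only [diagForm, Finset.mul_sum, mul_smul_comm, map_sum, map_smul,
      h.map_sq_mul_sq_mul_sq, smul_eq_mul, mul_add, mul_ite, mul_zero, Finset.sum_add_distrib,
      Finset.sum_ite_eq', Finset.mem_univ, if_true]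
    split_ifs
    · simp [mul_comm]; ring
    · simp [mul_comm]
  have h2 : X i ^ 2 * diagForm c ^ 2 = ∑ j, c j • (X i ^ 2 * X j ^ 2 * diagForm c) := by
    rw [sq (diagForm c), ← mul_assoc, mul_comm (X i ^ 2 * _)]
    nth_rw 1 [diagForm]
    rw [Finset.sum_mul]
    exact Finset.sum_congr rfl fun j _ => by
      simp only [smul_mul_assoc]
      congr 1
      ring
  rw [h2, map_sum]
  simp only [map_smul, h1, smul_eq_mul, mul_add, mul_ite, mul_zero, Finset.sum_add_distrib,
    Finset.sum_ite_eq', Finset.mem_univ, if_true, ← Finset.sum_mul]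
  rw [Finset.sum_congr rfl fun (j : Fin n) _ => show c j * ((m42 - m222) * c j) =
    (m42 - m222) * c j ^ 2 by ring, ← Finset.mul_sum]
  ring

end HasEvenMoments

lemma map_ofNat_mul_mvPolynomial {n : ℕ} (L : MvPolynomial (Fin n) ℝ →ₗ[ℝ] ℝ) (k : ℕ)
    [k.AtLeastTwo] (P : MvPolynomial (Fin n) ℝ) :
    L (ofNat(k) * P) = (ofNat(k) : ℝ) * L P := by
  rw [← Nat.cast_ofNat, ← nsmul_eq_mul, map_nsmul, nsmul_eq_mul, Nat.cast_ofNat]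

lemma sum_ite_eq_zero_const {n : ℕ} (i : Fin n) (t : ℝ) :
    ∑ k : Fin n, (if k = i then 0 else t) = ((n : ℝ) - 1) * t := by
  have h : ∀ k : Fin n, (if k = i then 0 else t) = t - if k = i then t else 0 := by
    intro k; split_ifs <;> ring
  simp only [h, Finset.sum_sub_distrib, Finset.sum_ite_eq', Finset.mem_univ, if_true,
    Finset.sum_const, Finset.card_univ, Fintype.card_fin, nsmul_eq_mul]
  ring

lemma sum_ite_eq_zero_ite_eq_const {n : ℕ} {i j : Fin n} (hij : i ≠ j) (s t : ℝ) :
    ∑ k : Fin n, (if k = i then 0 else if k = j then s else t) = s + ((n : ℝ) - 2) * t := by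
  have h : ∀ k : Fin n, (if k = i then 0 else if k = j then s else t) =
      t + (if k = j then s - t else 0) - if k = i then t else 0 := by
    intro k; split_ifs with h1 h2 <;> first | ring1 | exact absurd (h1.symm.trans h2) hij
  simp only [h, Finset.sum_sub_distrib, Finset.sum_add_distrib, Finset.sum_ite_eq',
    Finset.mem_univ, if_true, Finset.sum_const, Finset.card_univ, Fintype.card_fin, nsmul_eq_mul]
  ring

lemma pderiv_ofNat_eq_zero {n : ℕ} (i : Fin n) (k : ℕ) [k.AtLeastTwo] :
    MvPolynomial.pderiv i (ofNat(k) : MvPolynomial (Fin n) ℝ) = 0 := by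
  rw [← Nat.cast_ofNat, Derivation.map_natCast]

namespace IsMomentFunctional

open MvPolynomial

variable {n : ℕ} {K : ℝ} {L : MvPolynomial (Fin n) ℝ →ₗ[ℝ] ℝ} {m6 m4 m22 m42 m222 : ℝ}

lemma map_diagForm (h : IsMomentFunctional K L) (c : Fin n → ℝ) : L (diagForm c) = ∑ j, c j := by
  simp [diagForm, h.sq]

lemma four_le (h : IsMomentFunctional K L) (h' : HasEvenMoments L m6 m4 m22 m42 m222) (i : Fin n) :
    2 * m4 ≤ 1 + m6 := by
  have h1 := h.nonneg (X i ^ 2 + X i ^ 6 - 2 * X i ^ 4) fun x => by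
    simp only [map_add, map_sub, map_mul, map_pow, eval_X, map_ofNat]
    nlinarith [sq_nonneg (x i * (x i ^ 2 - 1))]
  rw [map_sub, map_add, map_ofNat_mul_mvPolynomial, h.sq, h'.six, h'.four] at h1
  linarith

lemma four_two_le_six (h : IsMomentFunctional K L) (h' : HasEvenMoments L m6 m4 m22 m42 m222)
    {i j : Fin n} (hij : i ≠ j) : m42 ≤ m6 := by
  have h1 := h.nonneg (X i ^ 6 + X j ^ 6 - (X i ^ 4 * X j ^ 2 + X j ^ 4 * X i ^ 2)) fun x => by
    simp only [map_add, map_sub, map_mul, map_pow, eval_X]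
    nlinarith [mul_nonneg (sq_nonneg (x i ^ 2 - x j ^ 2)) (add_nonneg (sq_nonneg (x i))
      (sq_nonneg (x j)))]
  rw [map_sub, map_add, map_add, h'.six, h'.six, h'.four_two i j hij,
    h'.four_two j i hij.symm] at h1
  linarith

lemma two_two_two_nonneg (h : IsMomentFunctional K L) (h' : HasEvenMoments L m6 m4 m22 m42 m222)
    (hn : 3 ≤ n) : 0 ≤ m222 := by
  obtain ⟨j, hij, -⟩ := Fin.exists_ne_ne hn ⟨0, by omega⟩ ⟨0, by omega⟩
  obtain ⟨k, hik, hjk⟩ := Fin.exists_ne_ne hn ⟨0, by omega⟩ j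
  rw [← h'.two_two_two _ j k hij hik hjk]
  refine h.nonneg _ fun x => ?_
  simp only [map_mul, map_pow, eval_X]
  positivity

lemma le_four_add_two_two (h : IsMomentFunctional K L)
    (h' : HasEvenMoments L m6 m4 m22 m42 m222) :
    (n : ℝ) ^ 2 ≤ n * m4 + n * (n - 1) * m22 := by
  have h1 := h.nonneg (diagForm (fun _ => 1) ^ 2 - (2 * n : ℝ) • diagForm (fun _ => 1) +
    ((n : ℝ) ^ 2) • 1) fun x => by
      simp only [map_add, map_sub, map_pow, smul_eval, map_one]
      nlinarith [sq_nonneg (eval x (diagForm fun _ => 1) - n)]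
  rw [map_add, map_sub, map_smul, map_smul, h.one, h.map_diagForm, h'.map_diagForm_sq] at h1
  simp at h1
  nlinarith

lemma two_two_sq_le (h : IsMomentFunctional K L) (h' : HasEvenMoments L m6 m4 m22 m42 m222)
    (i : Fin n) :
    ((n : ℝ) - 1) ^ 2 * m22 ^ 2 ≤ m222 * (n - 1) ^ 2 + (m42 - m222) * (n - 1) := by
  set c : Fin n → ℝ := fun k => if k = i then 0 else 1
  have hci : c i = 0 := if_pos rfl
  have hc : ∑ k, c k = (n : ℝ) - 1 := by simpa using sum_ite_eq_zero_const i 1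
  have hc2 : ∑ k, c k ^ 2 = (n : ℝ) - 1 := by
    rw [← hc]; exact Finset.sum_congr rfl fun k _ => by simp only [c]; split_ifs <;> norm_num
  have h1 := h.nonneg (X i ^ 2 * diagForm c ^ 2 -
    (2 * ((n - 1) * m22) : ℝ) • (X i ^ 2 * diagForm c) + (((n - 1) * m22) ^ 2) • X i ^ 2)
    fun x => by
      simp only [map_add, map_sub, map_mul, map_pow, smul_eval, eval_X]
      nlinarith [mul_nonneg (sq_nonneg (x i)) (sq_nonneg (eval x (diagForm c) - (n - 1) * m22))]
  rw [map_add, map_sub, map_smul, map_smul, h.sq, h'.map_sq_mul_diagForm,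
    h'.map_sq_mul_diagForm_sq, hci, hc, hc2] at h1
  simp only [smul_eq_mul] at h1
  nlinarith

lemma four_mul_two_two_two_le (h : IsMomentFunctional K L)
    (h' : HasEvenMoments L m6 m4 m22 m42 m222) (hn : 3 ≤ n) :
    4 * m222 ≤ (m42 - m222) * (5 + 9 / (n - 2)) := by
  set i : Fin n := ⟨0, by omega⟩
  obtain ⟨j, hij, -⟩ := Fin.exists_ne_ne hn i i
  have hn' : (3 : ℝ) ≤ n := by exact_mod_cast hn
  set s : ℝ := -(3 / ((n : ℝ) - 2)) with hs
  set c : Fin n → ℝ := fun k => if k = i then 0 else if k = j then 1 else s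
  have hci : c i = 0 := if_pos rfl
  have hcj : c j = 1 := by simp [c, hij.symm]
  set d : Fin n → ℝ := c + Pi.single j 2
  have hd : ∀ k, d k = if k = i then 0 else if k = j then 3 else s := by
    intro k
    simp only [d, c, Pi.add_apply, Pi.single_apply]
    split_ifs with h1 h2 <;> first | exact absurd (h1.symm.trans h2) hij | norm_num
  have hdi : d i = 0 := by simp [hd]
  have hd1 : ∑ k, d k = 0 := by
    simp only [hd]
    rw [sum_ite_eq_zero_ite_eq_const hij, hs]
    field_simp [show (n : ℝ) - 2 ≠ 0 by linarith]
    ring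
  have hd2 : ∑ k, d k ^ 2 = 9 + 9 / ((n : ℝ) - 2) := by
    have h1 : ∀ k, d k ^ 2 = if k = i then 0 else if k = j then 9 else s ^ 2 := by
      intro k; rw [hd]; split_ifs <;> norm_num
    simp only [h1]
    rw [sum_ite_eq_zero_ite_eq_const hij, hs]
    field_simp [show (n : ℝ) - 2 ≠ 0 by linarith]
    ring
  have hV : X j * pderiv j (diagForm c) = 2 * X j ^ 2 := by
    rw [X_mul_pderiv_diagForm, hcj, mul_one, smul_eq_C_mul, map_ofNat]
  have h1 := h.stretch j (X i ^ 2 * diagForm c ^ 2) fun x => by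
    simp only [map_mul, map_pow, eval_X]
    positivity
  have h2 : X i ^ 2 * diagForm c ^ 2 + X j * pderiv j (X i ^ 2 * diagForm c ^ 2) =
      X i ^ 2 * diagForm d ^ 2 - 4 * (X j ^ 4 * X i ^ 2) := by
    have h3 : X j * pderiv j (X i ^ 2 * diagForm c ^ 2) =
        2 * (X i ^ 2 * diagForm c) * (X j * pderiv j (diagForm c)) := by
      simp [hij]
      ring
    rw [h3, hV, diagForm_add_single, smul_eq_C_mul, map_ofNat]
    ring
  rw [h2, map_sub, map_ofNat_mul_mvPolynomial, h'.four_two j i hij.symm,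
    h'.map_sq_mul_diagForm_sq, hdi, hd1, hd2] at h1
  linear_combination h1

lemma le_six_add (h : IsMomentFunctional K L)
    (h' : HasEvenMoments L m6 m4 m22 m42 m222) (i : Fin n) (t : ℝ) :
    108 / 175 ≤ m6 + 2 * (m42 * (n - 1)) * t +
      (m222 * (n - 1) ^ 2 + (m42 - m222) * (n - 1)) * t ^ 2 := by
  set c : Fin n → ℝ := fun k => if k = i then 0 else t
  have hci : c i = 0 := if_pos rfl
  have hc : ∑ k, c k = ((n : ℝ) - 1) * t := sum_ite_eq_zero_const i t
  have hc2 : ∑ k, c k ^ 2 = ((n : ℝ) - 1) * t ^ 2 := by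
    rw [← sum_ite_eq_zero_const i]
    exact Finset.sum_congr rfl fun k _ => by simp only [c]; split_ifs <;> norm_num
  have hU : pderiv i (diagForm c) = 0 := by
    have := X_mul_pderiv_diagForm c i
    rw [hci, mul_zero, zero_smul] at this
    exact (mul_eq_zero.1 this).resolve_left (X_ne_zero i)
  have h1 := h.stretch i (75 * X i ^ 6 + 210 * (X i ^ 4 * diagForm c) +
    175 * (X i ^ 2 * diagForm c ^ 2) - 324 * X i ^ 2 + 648 * 1) fun x => by
      simp only [map_add, map_sub, map_mul, map_pow, eval_X, map_ofNat, map_one]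
      nlinarith [mul_nonneg (sq_nonneg (x i))
        (sq_nonneg (5 * eval x (diagForm c) + 3 * x i ^ 2)),
        mul_nonneg (sq_nonneg (x i ^ 2 - 3)) (add_nonneg (sq_nonneg (x i))
          (by norm_num : (0 : ℝ) ≤ 6))]
  have h2 : 75 * X i ^ 6 + 210 * (X i ^ 4 * diagForm c) +
      175 * (X i ^ 2 * diagForm c ^ 2) - 324 * X i ^ 2 + 648 * 1 + X i * pderiv i
      (75 * X i ^ 6 + 210 * (X i ^ 4 * diagForm c) +
      175 * (X i ^ 2 * diagForm c ^ 2) - 324 * X i ^ 2 + 648 * 1) =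
      525 * X i ^ 6 + 1050 * (X i ^ 4 * diagForm c) +
      525 * (X i ^ 2 * diagForm c ^ 2) - 972 * X i ^ 2 + 648 * 1 := by
    simp [hU, pderiv_ofNat_eq_zero]
    ring
  rw [h2] at h1
  rw [map_add, map_sub, map_add, map_add, map_ofNat_mul_mvPolynomial,
    map_ofNat_mul_mvPolynomial, map_ofNat_mul_mvPolynomial, map_ofNat_mul_mvPolynomial,
    map_ofNat_mul_mvPolynomial, h.one, h.sq, h'.six, h'.map_pow_four_mul_diagForm,
    h'.map_sq_mul_diagForm_sq, hci, hc, hc2] at h1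
  nlinarith

end IsMomentFunctional

lemma quadForm_nonneg_of_sq_le_mul {P B W : ℝ} (hP : 0 ≤ P) (hW : 0 ≤ W) (h : B ^ 2 ≤ P * W)
    (a s : ℝ) : 0 ≤ P * a ^ 2 + 2 * B * a * s + W * s ^ 2 := by
  rcases hP.eq_or_lt with rfl | hP
  · have hB : B = 0 := by nlinarith
    subst hB
    nlinarith [mul_nonneg hW (sq_nonneg s)]
  · refine nonneg_of_mul_nonneg_right ?_ hP
    nlinarith [sq_nonneg (P * a + B * s), mul_nonneg (sub_nonneg.2 h) (sq_nonneg s)]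

lemma sq_le_mul_of_forall_le {A b W c : ℝ} (hW : 0 < W) (h : ∀ t, c ≤ A + 2 * b * t + W * t ^ 2) :
    b ^ 2 ≤ (A - c) * W := by
  have h1 := h (-(b / W))
  have h2 : A + 2 * b * -(b / W) + W * (-(b / W)) ^ 2 = A - b ^ 2 / W := by
    field_simp; ring
  rw [h2] at h1
  rw [← div_le_iff₀ hW]
  linarith

/-- For large `N` the moment inequalities force the quadratic forms that occur in the second
moment of a cubic form to dominate `κ` times the identity. -/
lemma moment_bounds_of_large {N K m6 m4 m22 m42 m222 κ : ℝ}
    (hN : 100 * (K + 1) ≤ N) (h6 : m6 ≤ K) (h42 : m42 ≤ m6) (h222 : 0 ≤ m222)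
    (h4 : 2 * m4 ≤ 1 + m6) (hF1 : N ^ 2 ≤ N * m4 + N * (N - 1) * m22)
    (hF2 : (N - 1) ^ 2 * m22 ^ 2 ≤ m222 * (N - 1) ^ 2 + (m42 - m222) * (N - 1))
    (hF3 : 4 * m222 ≤ (m42 - m222) * (5 + 9 / (N - 2)))
    (hF4 : ∀ t, 108 / 175 ≤ m6 + 2 * (m42 * (N - 1)) * t +
      (m222 * (N - 1) ^ 2 + (m42 - m222) * (N - 1)) * t ^ 2)
    (hκ0 : 0 < κ) (hκ : κ ≤ 108 / 175 - 100 * (K + 1) / N) :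
    κ ≤ m222 ∧ κ ≤ m42 - m222 ∧ κ ≤ m6 ∧
      m42 ^ 2 ≤ (m6 - κ) * (m222 + (m42 - m222 - κ) / (N - 1)) := by
  have hA : 108 / 175 ≤ m6 := by simpa using hF4 0
  have hK : 0 ≤ K := by linarith
  have hN' : 100 ≤ N := by linarith
  have hκc : κ ≤ 108 / 175 := hκ.trans (by
    have : 0 ≤ 100 * (K + 1) / N := by positivity
    linarith)
  have hp : (N - 1) - (K + 1) / 2 ≤ (N - 1) * m22 := by
    have : N ≤ m4 + (N - 1) * m22 := by
      refine le_of_mul_le_mul_left ?_ (show 0 < N by linarith)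
      linarith
    linarith
  set W := m222 * (N - 1) ^ 2 + (m42 - m222) * (N - 1) with hW
  have hW1 : (N - 1) ^ 2 - (K + 1) * (N - 1) ≤ W := by
    refine le_trans ?_ hF2
    rw [← mul_pow]
    nlinarith
  have hD : N - 2 - 2 * (K + 1) ≤ m222 * (N - 2) := by
    have h1 : (N - 1) - (K + 1) ≤ m222 * (N - 2) + m42 := by
      refine le_of_mul_le_mul_left ?_ (show 0 < N - 1 by linarith)
      nlinarith
    linarith
  have hD' : 9 / 10 ≤ m222 := by
    refine le_of_mul_le_mul_right ?_ (show 0 < N - 2 by linarith)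
    linarith
  have hE : 108 / 175 ≤ m42 - m222 := by
    have h9 : 9 / (N - 2) ≤ 1 / 10 := by
      rw [div_le_iff₀ (by linarith)]; linarith
    by_contra! hlt
    have hpos : 0 ≤ 9 / (N - 2) := div_nonneg (by norm_num) (by linarith)
    nlinarith
  refine ⟨by linarith, by linarith, by linarith, ?_⟩
  have hW2 : (N - 1) * N / 3 ≤ W := by nlinarith
  have hdisc := sq_le_mul_of_forall_le (by nlinarith : 0 < W) hF4
  have hN1 : 0 < N - 1 := by linarith
  have hkey : κ * (N - 1) * m6 ≤ (108 / 175 - κ) * W := by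
    have h1 : 100 * (K + 1) / N * ((N - 1) * N / 3) ≤ (108 / 175 - κ) * W := by
      refine mul_le_mul (by linarith) hW2 (by nlinarith) (by linarith)
    have h2 : 100 * (K + 1) / N * ((N - 1) * N / 3) = 100 * (K + 1) * (N - 1) / 3 := by
      field_simp [show N ≠ 0 by linarith]
    have h3 : κ * m6 ≤ 1 * K := mul_le_mul (by linarith) h6 (by linarith) (by norm_num)
    linarith [mul_le_mul_of_nonneg_right h3 hN1.le, mul_nonneg hK hN1.le]
  have h5 : m222 + (m42 - m222 - κ) / (N - 1) = (W - κ * (N - 1)) / (N - 1) ^ 2 := by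
    rw [hW]; field_simp; ring
  rw [h5, ← mul_div_assoc, le_div_iff₀ (by positivity)]
  linarith [mul_nonneg hκ0.le (mul_nonneg hκ0.le hN1.le)]

namespace IsMomentFunctional

open MvPolynomial

variable {n : ℕ} {K κ : ℝ} {L : MvPolynomial (Fin n) ℝ →ₗ[ℝ] ℝ}

lemma le_two_two_two_and_le_map_sq_mul_diagForm_sq (h : IsMomentFunctional K L) (hK : 0 ≤ K)
    (hκ0 : 0 < κ) (hκ : κ ≤ 108 / 175 - 100 * (K + 1) / n) :
    (∀ i j k, i ≠ j → i ≠ k → j ≠ k → κ ≤ L (X i ^ 2 * X j ^ 2 * X k ^ 2)) ∧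
      ∀ (i : Fin n) (c : Fin n → ℝ), κ * ∑ j, c j ^ 2 ≤ L (X i ^ 2 * diagForm c ^ 2) := by
  rcases Nat.eq_zero_or_pos n with rfl | hn0
  · exact ⟨fun i => i.elim0, fun i => i.elim0⟩
  have hnpos : (0 : ℝ) < n := by exact_mod_cast hn0
  have hN : 100 * (K + 1) ≤ n := by
    have h1 : 100 * (K + 1) / n ≤ 1 := by linarith
    rwa [div_le_one hnpos] at h1
  have hn : 3 ≤ n := by
    have : (3 : ℝ) ≤ n := by linarith
    exact_mod_cast this
  obtain ⟨m6, m4, m22, m42, m222, h'⟩ := h.exists_hasEvenMoments hn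
  set i₀ : Fin n := ⟨0, hn0⟩
  obtain ⟨j₀, hij, -⟩ := Fin.exists_ne_ne hn i₀ i₀
  obtain ⟨hD, hE, hA, hB⟩ := moment_bounds_of_large hN (by rw [← h'.six i₀]; exact h.sixth_le i₀)
    (h.four_two_le_six h' hij) (h.two_two_two_nonneg h' hn)
    (h.four_le h' i₀) (h.le_four_add_two_two h') (h.two_two_sq_le h' i₀)
    (h.four_mul_two_two_two_le h' hn) (h.le_six_add h' i₀) hκ0 hκ
  refine ⟨fun i j k hij hik hjk => by rwa [h'.two_two_two i j k hij hik hjk], fun i c => ?_⟩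
  rw [h'.map_sq_mul_diagForm_sq]
  have hn1 : (0 : ℝ) < (n : ℝ) - 1 := by linarith
  have hs := Finset.add_sum_erase Finset.univ c (Finset.mem_univ i)
  have hq := Finset.add_sum_erase Finset.univ (fun j => c j ^ 2) (Finset.mem_univ i)
  have hcs := sq_sum_le_card_mul_sum_sq (s := Finset.univ.erase i) (f := c)
  rw [Finset.card_erase_of_mem (Finset.mem_univ i), Finset.card_univ, Fintype.card_fin,
    Nat.cast_sub hn0, Nat.cast_one] at hcs
  beta_reduce at hq
  rw [← hs, ← hq]
  generalize ∑ j ∈ Finset.univ.erase i, c j = s at *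
  generalize ∑ j ∈ Finset.univ.erase i, c j ^ 2 = q at *
  have h1 := quadForm_nonneg_of_sq_le_mul (sub_nonneg.2 hA) (by
    have := div_nonneg (sub_nonneg.2 hE) hn1.le
    linarith) hB (c i) s
  have h2 : (m42 - m222 - κ) / (n - 1) * s ^ 2 ≤ (m42 - m222 - κ) * q := by
    rw [div_mul_eq_mul_div, div_le_iff₀ hn1, mul_assoc]
    exact mul_le_mul_of_nonneg_left (by linarith) (sub_nonneg.2 hE)
  linear_combination h1 + h2

end IsMomentFunctional

lemma Finsupp.degree_eq_three {σ : Type*} {I : σ →₀ ℕ} (h : I.degree = 3) :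
    (∃ i j, I = Finsupp.single i 1 + Finsupp.single j 2) ∨
      ∃ i j k, i ≠ j ∧ i ≠ k ∧ j ≠ k ∧
        I = Finsupp.single i 1 + Finsupp.single j 1 + Finsupp.single k 1 := by
  classical
  have h1 : Multiset.card (Finsupp.toMultiset I) = 3 := by
    rw [Finsupp.card_toMultiset, ← h, Finsupp.degree_apply]
    rfl
  obtain ⟨i, j, k, hijk⟩ := Multiset.card_eq_three.1 h1
  have hI : I = Finsupp.single i 1 + Finsupp.single j 1 + Finsupp.single k 1 := by
    apply Multiset.toFinsupp.symm.injective
    rw [Multiset.toFinsupp_symm_apply, Multiset.toFinsupp_symm_apply, hijk]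
    simp [Finsupp.toMultiset_single]
  have h2 : ∀ a : σ, Finsupp.single a 2 = Finsupp.single a 1 + Finsupp.single a 1 := fun a => by
    rw [← Finsupp.single_add]
  by_cases hij : i = j
  · subst hij
    exact Or.inl ⟨k, i, by rw [hI, h2, add_comm]⟩
  by_cases hik : i = k
  · subst hik
    exact Or.inl ⟨j, i, by rw [hI, h2]; abel⟩
  by_cases hjk : j = k
  · subst hjk
    exact Or.inl ⟨i, j, by rw [hI, h2]; abel⟩
  exact Or.inr ⟨i, j, k, hij, hik, hjk, hI⟩

lemma Finsupp.single_one_add_single_two_mod {σ : Type*} [DecidableEq σ] (i j v : σ) :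
    (Finsupp.single i 1 + Finsupp.single j 2 : σ →₀ ℕ) v % 2 = if v = i then 1 else 0 := by
  rw [Finsupp.add_apply, Finsupp.single_apply, Finsupp.single_apply]
  split_ifs <;> grind

lemma Finsupp.eq_of_degree_eq_three_of_mod_two_eq {σ : Type*} {i j k : σ} (hij : i ≠ j)
    (hik : i ≠ k) (hjk : j ≠ k) {J : σ →₀ ℕ} (hJ : J.degree = 3)
    (h : ∀ v, J v % 2 =
      (Finsupp.single i 1 + Finsupp.single j 1 + Finsupp.single k 1 : σ →₀ ℕ) v % 2) :
    J = Finsupp.single i 1 + Finsupp.single j 1 + Finsupp.single k 1 := by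
  classical
  set I : σ →₀ ℕ := Finsupp.single i 1 + Finsupp.single j 1 + Finsupp.single k 1 with hI
  have hle : I ≤ J := by
    intro v
    have h1 : I v ≤ 1 := by
      simp only [hI, Finsupp.add_apply, Finsupp.single_apply]
      split_ifs <;> grind
    have := h v
    omega
  obtain ⟨M, rfl⟩ := exists_add_of_le hle
  have hM : M.degree = 0 := by
    have : I.degree = 3 := by simp [hI, map_add]
    rw [map_add, this] at hJ
    omega
  rw [Finsupp.degree_eq_zero_iff] at hM
  rw [hM, add_zero]

namespace IsMomentFunctional

open MvPolynomial

variable {n : ℕ} {K κ : ℝ} {L : MvPolynomial (Fin n) ℝ →ₗ[ℝ] ℝ}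

lemma map_monomial_mul_monomial_eq_zero (h : IsMomentFunctional K L) {I J : Fin n →₀ ℕ}
    (hIJ : (fun v => I v % 2) ≠ fun v => J v % 2) (a b : ℝ) :
    L (monomial I a * monomial J b) = 0 := by
  obtain ⟨v, hv⟩ := Function.ne_iff.1 hIJ
  have h1 : monomial (I + J) (a * b) = (a * b) • monomial (I + J) (1 : ℝ) := by
    rw [smul_monomial, smul_eq_mul, mul_one]
  rw [monomial_mul, h1, map_smul, h.odd (I + J) v, smul_zero]
  rw [Finsupp.add_apply, Nat.odd_iff]
  omega

/-- A sum of monomials of degree three, all of the same parity, has a large second moment. -/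
lemma le_map_sq_of_parity_class
    (hD : ∀ i j k, i ≠ j → i ≠ k → j ≠ k → κ ≤ L (X i ^ 2 * X j ^ 2 * X k ^ 2))
    (hQ : ∀ (i : Fin n) (c : Fin n → ℝ), κ * ∑ j, c j ^ 2 ≤ L (X i ^ 2 * diagForm c ^ 2))
    {f : MvPolynomial (Fin n) ℝ} (hf : ∀ I ∈ f.support, I.degree = 3) (p : Fin n → ℕ) :
    κ * ∑ I ∈ f.support with (fun v => I v % 2) = p, coeff I f ^ 2 ≤
      L ((∑ I ∈ f.support with (fun v => I v % 2) = p, monomial I (coeff I f)) ^ 2) := by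
  classical
  rcases (f.support.filter fun I => (fun v => I v % 2) = p).eq_empty_or_nonempty with he | ⟨I, hI⟩
  · simp [he]
  obtain ⟨hIf, rfl⟩ := Finset.mem_filter.1 hI
  rcases Finsupp.degree_eq_three (hf I hIf) with ⟨i, j, rfl⟩ | ⟨i, j, k, hij, hik, hjk, hIeq⟩
  · set φ : Fin n → Fin n →₀ ℕ := fun j => Finsupp.single i 1 + Finsupp.single j 2 with hφ
    have hφp : ∀ a, (fun v => φ a v % 2) = fun v => φ j v % 2 := fun a => by
      ext v
      simp only [hφ, Finsupp.single_one_add_single_two_mod]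
    have hφi : Function.Injective φ := fun a b hab =>
      Finsupp.single_left_injective two_ne_zero (add_left_cancel hab)
    have hsub : (f.support.filter fun I => (fun v => I v % 2) = fun v => φ j v % 2) ⊆
        Finset.univ.image φ := by
      intro J hJ
      obtain ⟨hJf, hJp⟩ := Finset.mem_filter.1 hJ
      rw [Finset.mem_image]
      have hJp' : ∀ v, J v % 2 = if v = i then 1 else 0 := fun v =>
        (congrFun hJp v).trans (Finsupp.single_one_add_single_two_mod i j v)
      rcases Finsupp.degree_eq_three (hf J hJf) with ⟨a, b, rfl⟩ | ⟨a, b, c, hab, hac, hbc, rfl⟩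
      · have := hJp' a
        rw [Finsupp.single_one_add_single_two_mod] at this
        refine ⟨b, Finset.mem_univ _, ?_⟩
        have hai : a = i := by grind
        rw [hφ, hai]
      · have ha := hJp' a
        have hb := hJp' b
        simp [hab, hac, hbc, hab.symm] at ha hb
        exact absurd (ha.trans hb.symm) hab
    have hsum : ∀ {M : Type} [AddCommMonoid M] (F : (Fin n →₀ ℕ) → M),
        (∀ I, coeff I f = 0 → F I = 0) →
        ∑ I ∈ f.support with (fun v => I v % 2) = fun v => φ j v % 2, F I = ∑ a, F (φ a) := by
      intro M _ F hF
      rw [Finset.sum_subset hsub, Finset.sum_image hφi.injOn]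
      intro J hJ hJ'
      obtain ⟨a, -, rfl⟩ := Finset.mem_image.1 hJ
      refine hF _ (not_not.1 fun hne => hJ' ?_)
      exact Finset.mem_filter.2 ⟨mem_support_iff.2 hne, hφp a⟩
    rw [hsum (fun I => coeff I f ^ 2) (by simp), hsum (fun I => monomial I (coeff I f))
      (by simp +contextual)]
    convert hQ i fun a => coeff (φ a) f using 2
    rw [← mul_pow, diagForm, Finset.mul_sum]
    congr 1
    refine Finset.sum_congr rfl fun a _ => ?_
    rw [X_pow_eq_monomial, smul_monomial, X, monomial_mul]
    simp [hφ]
  · have hcls : (f.support.filter fun J => (fun v => J v % 2) = fun v => I v % 2) = {I} := by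
      ext J
      rw [Finset.mem_filter, Finset.mem_singleton]
      refine ⟨fun ⟨hJ, hJp⟩ => ?_, fun hJ => by rw [hJ]; exact ⟨hIf, rfl⟩⟩
      subst hIeq
      exact Finsupp.eq_of_degree_eq_three_of_mod_two_eq hij hik hjk (hf J hJ) (congrFun hJp)
    rw [hcls, Finset.sum_singleton, Finset.sum_singleton]
    have h1 : (monomial I (coeff I f)) ^ 2 =
        (coeff I f ^ 2) • (X i ^ 2 * X j ^ 2 * X k ^ 2 : MvPolynomial (Fin n) ℝ) := by
      simp only [X_pow_eq_monomial, smul_monomial, monomial_mul, monomial_pow, hIeq]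
      simp
    rw [h1, map_smul, smul_eq_mul, mul_comm]
    exact mul_le_mul_of_nonneg_left (hD i j k hij hik hjk) (sq_nonneg _)

lemma le_map_sq_of_isHomogeneous_three (h : IsMomentFunctional K L)
    (hD : ∀ i j k, i ≠ j → i ≠ k → j ≠ k → κ ≤ L (X i ^ 2 * X j ^ 2 * X k ^ 2))
    (hQ : ∀ (i : Fin n) (c : Fin n → ℝ), κ * ∑ j, c j ^ 2 ≤ L (X i ^ 2 * diagForm c ^ 2))
    {f : MvPolynomial (Fin n) ℝ} (hf : ∀ I ∈ f.support, I.degree = 3) :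
    κ * ∑ I ∈ f.support, coeff I f ^ 2 ≤ L (f ^ 2) := by
  classical
  set par : (Fin n →₀ ℕ) → Fin n → ℕ := fun I v => I v % 2
  have hmem : ∀ I ∈ f.support, par I ∈ f.support.image par := fun I hI =>
    Finset.mem_image_of_mem _ hI
  have hfs : f = ∑ p ∈ f.support.image par, ∑ I ∈ f.support with par I = p,
      monomial I (coeff I f) := by
    rw [Finset.sum_fiberwise_of_maps_to hmem]
    exact f.as_sum
  have hsq : L (f ^ 2) = ∑ p ∈ f.support.image par,
      L ((∑ I ∈ f.support with par I = p, monomial I (coeff I f)) ^ 2) := by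
    nth_rw 1 [hfs]
    rw [pow_two, Finset.sum_mul_sum, map_sum]
    refine Finset.sum_congr rfl fun p hp => ?_
    rw [map_sum, Finset.sum_eq_single_of_mem p hp, pow_two]
    intro q _ hqp
    rw [Finset.sum_mul_sum, map_sum]
    refine Finset.sum_eq_zero fun I hI => ?_
    rw [map_sum]
    refine Finset.sum_eq_zero fun J hJ => h.map_monomial_mul_monomial_eq_zero ?_ _ _
    change par I ≠ par J
    rw [(Finset.mem_filter.1 hI).2, (Finset.mem_filter.1 hJ).2]
    exact hqp.symm
  rw [hsq, ← Finset.sum_fiberwise_of_maps_to hmem, Finset.mul_sum]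
  exact Finset.sum_le_sum fun p _ => le_map_sq_of_parity_class hD hQ hf p

end IsMomentFunctional

/-- Proposition A.4: for an `H_n`-invariant, isotropic, log-concave probability measure `η`
on ℝ^n and any degree-3 homogeneous polynomial `f` with `coeff_3(f) = 1`:
`∫ f² dη ≥ 108/175 - C/n` for a universal constant `C ≥ 0`. -/
theorem cubic_second_moment_bound :
    ∃ C : ℝ, 0 ≤ C ∧
      ∀ (n : ℕ), 1 ≤ n → ∀ η : Measure (Fin n → ℝ),
        IsProbabilityMeasure η → IsHnInvariant η → IsIsotropic η → IsLogConcave η →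
        ∀ f : MvPolynomial (Fin n) ℝ,
          f.IsHomogeneous 3 → coeffNorm 3 f = 1 →
          108 / 175 - C / n ≤ ∫ x, (MvPolynomial.eval x f) ^ 2 ∂η := by
  have hK : 0 ≤ (momentBound 6).toReal := ENNReal.toReal_nonneg
  refine ⟨100 * ((momentBound 6).toReal + 1), by positivity,
    fun n _ η _ h hi hl f hf hnorm => ?_⟩
  obtain ⟨L, hL, hLint⟩ := exists_isMomentFunctional h hi hl
  rcases le_or_gt (108 / 175 - 100 * ((momentBound 6).toReal + 1) / n) 0 with hκ | hκ
  · exact hκ.trans (integral_nonneg fun x => sq_nonneg _)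
  have hdeg : ∀ I ∈ f.support, I.degree = 3 := fun I hI => by
    rw [Finsupp.degree_eq_weight_one]
    exact hf (MvPolynomial.mem_support_iff.1 hI)
  have hsum : ∑ I ∈ f.support, MvPolynomial.coeff I f ^ 2 = 1 := by
    rw [coeffNorm, Real.sqrt_eq_one, Finset.filter_true_of_mem] at hnorm
    · exact hnorm
    · exact fun I hI => hdeg I hI
  obtain ⟨hD, hQ⟩ := hL.le_two_two_two_and_le_map_sq_mul_diagForm_sq hK hκ le_rfl
  have hfin := hL.le_map_sq_of_isHomogeneous_three hD hQ hdeg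
  rw [hsum, mul_one, hLint] at hfin
  simpa only [map_pow] using hfin
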